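/- arXiv:2601.10419 — 10 statements merged into one kernel-verified Lean document; each statement's English description precedes it below -/
import Mathlib

section
/- Let R be a generalized root system in V. If α ∈ R is an isotropic root (i.e. (α,α) = 0), k is a nonzero scalar, and kα ∈ R, then k = 1 or k = −1. -/
open scoped Classical

/-- A generalized root system (Serganova): a finite set `R` of nonzero vectors in a
finite-dimensional complex vector space `V` equipped with a nondegenerate symmetric
bilinear form `B`, spanning `V`, with `R = -R`, satisfying the integrality/reflection
axiom at non-isotropic roots and the odd-reflection axiom at isotropic roots. -/
structure IsGRS {V : Type*} [AddCommGroup V] [Module ℂ V]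
    (B : LinearMap.BilinForm ℂ V) (R : Set V) : Prop where
  finite : R.Finite
  nondegenerate : B.Nondegenerate
  symm : ∀ x y : V, B x y = B y x
  zero_not_mem : (0 : V) ∉ R
  span_eq_top : Submodule.span ℂ R = ⊤
  neg_mem : ∀ α ∈ R, -α ∈ R
  pairing_int : ∀ α ∈ R, ∀ β ∈ R, B α α ≠ 0 → ∃ k : ℤ, 2 * B β α = (k : ℂ) * B α α
  reflect_mem : ∀ α ∈ R, ∀ β ∈ R, B α α ≠ 0 → β - (2 * B β α / B α α) • α ∈ R
  iso_reflect : ∀ α ∈ R, B α α = 0 → ∃ r : V → V, Set.BijOn r R R ∧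
    ∀ β ∈ R, (B β α = 0 → r β = β) ∧ (B β α ≠ 0 → (r β = β + α ∨ r β = β - α))

/-- Two non-isotropic roots differing by a multiple of an isotropic vector have the same
norm up to sign. -/
theorem norm_eq_or_neg {V : Type*} [AddCommGroup V] [Module ℂ V]
    (B : LinearMap.BilinForm ℂ V) (R : Set V) (hR : IsGRS B R)
    (α : V) (hiso : B α α = 0) (β γ : V) (hβ : β ∈ R) (hγ : γ ∈ R) (x : ℂ)
    (h : γ = β + x • α) (hb : B β β ≠ 0) (hg : B γ γ ≠ 0) :
    B γ γ = B β β ∨ B γ γ = - B β β := by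
  obtain ⟨m, hm⟩ := hR.pairing_int β hβ γ hγ hb
  obtain ⟨n, hn⟩ := hR.pairing_int γ hγ β hβ hg
  have hs := hR.symm γ β
  have hsum : 2 * B β γ = B β β + B γ γ := by
    have := hR.symm α β
    subst h
    simp [hiso, this]
    ring
  have e1 : B γ γ = ((m - 1 : ℤ) : ℂ) * B β β := by
    push_cast; linear_combination hm - hsum - 2 * hs
  have e2 : B β β = ((n - 1 : ℤ) : ℂ) * B γ γ := by
    push_cast; linear_combination hn - hsum
  have e3 : (((m - 1) * (n - 1) : ℤ) : ℂ) = 1 := by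
    have : (((m - 1) * (n - 1) : ℤ) : ℂ) * B β β = 1 * B β β := by
      push_cast at *
      linear_combination (-1 : ℂ) * e2 - ((n : ℂ) - 1) * e1
    exact mul_right_cancel₀ hb this
  have e4 : (m - 1) * (n - 1) = 1 := by exact_mod_cast e3
  rcases Int.eq_one_or_neg_one_of_mul_eq_one e4 with h1 | h1
  · left; rw [e1, h1]; simp
  · right; rw [e1, h1]; simp

/-- Shifting a root by an isotropic root not orthogonal to it. -/
theorem exists_shift {V : Type*} [AddCommGroup V] [Module ℂ V]
    (B : LinearMap.BilinForm ℂ V) (R : Set V) (hR : IsGRS B R)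
    (α : V) (hiso : B α α = 0) (k : ℂ) (hk : k ≠ 0) (hkα : k • α ∈ R)
    (γ : V) (hγ : γ ∈ R) (hc : B γ α ≠ 0) :
    ∃ x : ℂ, (x = k ∨ x = -k) ∧ γ + x • α ∈ R := by
  obtain ⟨r, hr, h⟩ := hR.iso_reflect (k • α) hkα (by simp [hiso])
  have hm := hr.mapsTo hγ
  rcases (h γ hγ).2 (by simp [hk, hc]) with h1 | h1
  · exact ⟨k, Or.inl rfl, h1 ▸ hm⟩
  · refine ⟨-k, Or.inr rfl, ?_⟩
    rw [h1] at hm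
    simpa [sub_eq_add_neg] using hm

theorem isotropic_multiple {V : Type*} [AddCommGroup V] [Module ℂ V] [FiniteDimensional ℂ V]
    (B : LinearMap.BilinForm ℂ V) (R : Set V) (hR : IsGRS B R)
    (α : V) (hα : α ∈ R) (hiso : B α α = 0)
    (k : ℂ) (hk : k ≠ 0) (hkα : k • α ∈ R) :
    k = 1 ∨ k = -1 := by
  have hex : ∃ β ∈ R, B β α ≠ 0 := by
    by_contra! hcon
    have hz : B α = 0 := by
      apply LinearMap.ext_on hR.span_eq_top
      intro β hβ
      rw [hR.symm α β, hcon β hβ]; rfl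
    have : α = 0 := hR.nondegenerate.1 α (fun y => by rw [hz]; rfl)
    exact hR.zero_not_mem (this ▸ hα)
  have nrm : ∀ (γ : V) (x : ℂ), B (γ + x • α) (γ + x • α) = B γ γ + 2 * x * B γ α := by
    intro γ x
    simp [hiso, hR.symm α γ]
    ring
  have hα1 : (1 : ℂ) • α ∈ R := by simpa using hα
  by_cases hI : ∃ γ ∈ R, B γ α ≠ 0 ∧ B γ γ = 0
  · obtain ⟨γ, hγ, hc, h0⟩ := hI
    obtain ⟨x, hx, hxR⟩ := exists_shift B R hR α hiso 1 one_ne_zero hα1 γ hγ hc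
    obtain ⟨y, hy, hyR⟩ := exists_shift B R hR α hiso k hk hkα γ hγ hc
    have hx0 : x ≠ 0 := by rcases hx with rfl | rfl <;> simp
    have hy0 : y ≠ 0 := by rcases hy with rfl | rfl <;> simp [hk]
    have key := norm_eq_or_neg B R hR α hiso _ _ hxR hyR (y - x) (by module)
      (by rw [nrm, h0]; simp [hx0, hc]) (by rw [nrm, h0]; simp [hy0, hc])
    rw [nrm, nrm, h0] at key
    have : y = x ∨ y = -x := by
      rcases key with h | h
      · left; apply mul_right_cancel₀ hc; linear_combination h / 2
      · right; apply mul_right_cancel₀ hc; linear_combination h / 2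
    grind
  · push Not at hI
    obtain ⟨β, hβ, hc⟩ := hex
    obtain ⟨x, hx, hxR⟩ := exists_shift B R hR α hiso 1 one_ne_zero hα1 β hβ hc
    obtain ⟨y, hy, hyR⟩ := exists_shift B R hR α hiso k hk hkα β hβ hc
    have hx0 : x ≠ 0 := by rcases hx with rfl | rfl <;> simp
    have hy0 : y ≠ 0 := by rcases hy with rfl | rfl <;> simp [hk]
    have main : ∀ z : ℂ, z ≠ 0 → β + z • α ∈ R → B β β = - (z * B β α) := by
      intro z hz hzR
      have key := norm_eq_or_neg B R hR α hiso β _ hβ hzR z rfl (hI β hβ hc)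
        (hI _ hzR (by simpa [hiso] using hc))
      rw [nrm] at key
      rcases key with h | h
      · exfalso
        have : z * B β α = 0 := by linear_combination h / 2
        exact mul_ne_zero hz hc this
      · linear_combination h / 2
    have : y = x := by
      apply mul_right_cancel₀ hc
      linear_combination main y hy0 hyR - main x hx0 hxR
    grind
end

section
/- Let R be a generalized root system, α ∈ R^im, β ∈ R^re with (β,α) ≠ 0. If β+α ∈ R and β+α is a real root, then (α,β^∨) = −2; if β−α ∈ R and β−α is a real root, then (α,β^∨) = 2. -/
open scoped Classical

/-- Key step for the sum: integrality at `β` and `β + α` forces the value `-2`. -/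
theorem grs_aux {V : Type*} [AddCommGroup V] [Module ℂ V]
    (B : LinearMap.BilinForm ℂ V) (R : Set V) (hR : IsGRS B R)
    (α β : V) (hα : α ∈ R) (hαiso : B α α = 0)
    (hβ : β ∈ R) (hβre : B β β ≠ 0) (hpair : B β α ≠ 0)
    (hs : β + α ∈ R) (hre : B (β + α) (β + α) ≠ 0) : 2 * B α β = -2 * B β β := by
  obtain ⟨n, hn⟩ := hR.pairing_int β hβ α hα hβre
  obtain ⟨k, hk⟩ := hR.pairing_int (β + α) hs α hα hre
  have hsym := hR.symm β α
  simp only [map_add, LinearMap.add_apply, hαiso, hsym, add_zero] at hk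
  have h1 : (n : ℂ) = k * (1 + n) := by
    apply mul_right_cancel₀ hβre
    linear_combination hk - hn + (k : ℂ) * hn
  have h2 : n = k * (1 + n) := by exact_mod_cast h1
  have hn0 : n ≠ 0 := by
    rintro rfl
    apply hpair
    rw [hsym]
    simpa using hn
  have h3 : (1 + n) * (1 - k) = 1 := by linear_combination h2
  have h4 : n = -2 := by
    rcases Int.eq_one_or_neg_one_of_mul_eq_one h3 with h | h <;> omega
  rw [hn, h4]
  norm_num

/-- Serganova, Lemma 1.8(b): for `α` isotropic and `β` real with `(β,α) ≠ 0`, if `β + α`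
is a real root then `(α,β^∨) = -2`, and if `β - α` is a real root then `(α,β^∨) = 2`. -/
theorem pairing_of_real_sum {V : Type*} [AddCommGroup V] [Module ℂ V] [FiniteDimensional ℂ V]
    (B : LinearMap.BilinForm ℂ V) (R : Set V) (hR : IsGRS B R)
    (α β : V) (hα : α ∈ R) (hαiso : B α α = 0)
    (hβ : β ∈ R) (hβre : B β β ≠ 0) (hpair : B β α ≠ 0) :
    (β + α ∈ R → B (β + α) (β + α) ≠ 0 → 2 * B α β / B β β = -2) ∧
    (β - α ∈ R → B (β - α) (β - α) ≠ 0 → 2 * B α β / B β β = 2) := by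
  constructor
  · intro hs hre
    rw [div_eq_iff hβre]
    exact grs_aux B R hR α β hα hαiso hβ hβre hpair hs hre
  · intro hs hre
    rw [div_eq_iff hβre]
    have h := grs_aux B R hR (-α) β (hR.neg_mem α hα) (by simpa using hαiso) hβ hβre
      (by simpa using hpair) (by rwa [← sub_eq_add_neg]) (by rwa [← sub_eq_add_neg])
    simp only [map_neg, LinearMap.neg_apply] at h
    linear_combination -h
end

section
/- Let R be a generalized root system, α ∈ R^im, β ∈ R^re with (β,α) ≠ 0. If β+α ∈ R and β+α is isotropic, then m_β^+(α) = 2 (i.e. α+β ∈ R but α+2β ∉ R); similarly, if β−α ∈ R and β−α is isotropic, then m_β^−(α) = 2. -/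
open scoped Classical

/-- `mPlus R α β = q + 1` where `q` is the largest natural number such that
`β + k • α ∈ R` for all `0 ≤ k ≤ q` (the upward part of the `α`-string through `β`). -/
noncomputable def mPlus {V : Type*} [AddCommGroup V] (R : Set V) (α β : V) : ℕ :=
  sSup {q : ℕ | ∀ k : ℕ, k ≤ q → β + k • α ∈ R} + 1

/-- `mMinus R α β = r + 1` where `r` is the largest natural number such that
`β - k • α ∈ R` for all `0 ≤ k ≤ r` (the downward part of the `α`-string through `β`). -/
noncomputable def mMinus {V : Type*} [AddCommGroup V] (R : Set V) (α β : V) : ℕ :=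
  sSup {q : ℕ | ∀ k : ℕ, k ≤ q → β - k • α ∈ R} + 1

theorem aux_plus {V : Type*} [AddCommGroup V] [Module ℂ V]
    (B : LinearMap.BilinForm ℂ V) (R : Set V) (hR : IsGRS B R)
    (α β : V) (hα : α ∈ R) (hαiso : B α α = 0)
    (hβ : β ∈ R) (hβre : B β β ≠ 0)
    (hs : β + α ∈ R) (hiso : B (β + α) (β + α) = 0) : mPlus R β α = 2 := by
  have hsym := hR.symm α β
  simp only [map_add, LinearMap.add_apply] at hiso
  have h2 : α + 2 • β ∉ R := by
    intro hmem
    have hn : B (α + 2 • β) (α + 2 • β) = 2 * B β β := by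
      simp only [map_add, LinearMap.add_apply, two_nsmul]
      linear_combination 2 * hiso - hαiso
    have hp : 2 * B β (α + 2 • β) = 3 * B β β := by
      simp only [map_add, two_nsmul]
      linear_combination hiso - hαiso - hsym
    obtain ⟨k, hk⟩ := hR.pairing_int _ hmem β hβ (by rw [hn]; simpa using hβre)
    rw [hp, hn] at hk
    have h3 : (3 : ℂ) = (k : ℂ) * 2 := by
      apply mul_right_cancel₀ hβre
      linear_combination hk
    have h4 : (3 : ℤ) = k * 2 := by exact_mod_cast h3
    omega
  have hset : {q : ℕ | ∀ k : ℕ, k ≤ q → α + k • β ∈ R} = Set.Iic 1 := by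
    ext q
    simp only [Set.mem_ofPred_eq, Set.mem_Iic]
    constructor
    · intro h
      by_contra hq
      exact h2 (h 2 (by omega))
    · intro hq k hk
      have : k = 0 ∨ k = 1 := by omega
      rcases this with rfl | rfl
      · simpa using hα
      · simpa [add_comm] using hs
  rw [mPlus, hset, csSup_Iic]

/-- For `α` isotropic and `β` real with `(β,α) ≠ 0`: if `β + α` is an isotropic root then
`m_β⁺(α) = 2`, and if `β - α` is an isotropic root then `m_β⁻(α) = 2`. -/
theorem string_of_iso_sum {V : Type*} [AddCommGroup V] [Module ℂ V] [FiniteDimensional ℂ V]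
    (B : LinearMap.BilinForm ℂ V) (R : Set V) (hR : IsGRS B R)
    (α β : V) (hα : α ∈ R) (hαiso : B α α = 0)
    (hβ : β ∈ R) (hβre : B β β ≠ 0) (hpair : B β α ≠ 0) :
    (β + α ∈ R → B (β + α) (β + α) = 0 → mPlus R β α = 2) ∧
    (β - α ∈ R → B (β - α) (β - α) = 0 → mMinus R β α = 2) := by
  refine ⟨aux_plus B R hR α β hα hαiso hβ hβre, fun hs hiso => ?_⟩
  have e : mMinus R β α = mPlus R (-β) α := by
    simp [mMinus, mPlus, sub_eq_add_neg]
  rw [e]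
  have e2 : -β + α = -(β - α) := by abel
  refine aux_plus B R hR α (-β) hα hαiso (hR.neg_mem _ hβ) (by simpa using hβre) ?_ ?_
  · rw [e2]; exact hR.neg_mem _ hs
  · rw [e2, map_neg, map_neg, LinearMap.neg_apply, neg_neg]; exact hiso
end

section
/- Let R be a generalized root system, α ∈ R^im, β ∈ R^re with (β,α) ≠ 0. If β+α ∈ R and β+α is a real root, then m_β^+(α) = 3 (i.e. α+β, α+2β ∈ R but α+3β ∉ R); similarly, if β−α ∈ R and β−α is a real root, then m_β^−(α) = 3. -/
open scoped Classical

/-- The upward half of the statement. -/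
theorem string_aux {V : Type*} [AddCommGroup V] [Module ℂ V]
    (B : LinearMap.BilinForm ℂ V) (R : Set V) (hR : IsGRS B R)
    (α β : V) (hα : α ∈ R) (hαiso : B α α = 0)
    (hβ : β ∈ R) (hβre : B β β ≠ 0) (hpair : B β α ≠ 0)
    (hs : β + α ∈ R) (hsre : B (β + α) (β + α) ≠ 0) : mPlus R β α = 3 := by
  have hsym := hR.symm α β
  obtain ⟨n, hn⟩ := hR.pairing_int β hβ α hα hβre
  obtain ⟨m, hm⟩ := hR.pairing_int (β + α) hs α hα hsre
  have hn0 : n ≠ 0 := by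
    rintro rfl
    apply hpair
    rw [← hsym]
    simpa using hn
  have hmn : n = m * (1 + n) := by
    simp only [map_add, LinearMap.add_apply, hαiso, ← hsym] at hm
    have h : ((n : ℂ) - m * (1 + n)) * B β β = 0 := by
      linear_combination hm - (1 - (m : ℂ)) * hn
    have h2 := (mul_eq_zero.mp h).resolve_right hβre
    have h3 : (n : ℂ) = m * (1 + n) := by linear_combination h2
    exact_mod_cast h3
  have hn2 : n = -2 := by
    have hd : (1 + n) ∣ 1 := ⟨1 - m, by linear_combination -hmn⟩
    have := Int.isUnit_iff.mp (isUnit_of_dvd_one hd)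
    omega
  subst hn2
  have hab : B α β = - B β β := by
    push_cast at hn
    linear_combination hn / 2
  have h2 : α + (2 : ℕ) • β ∈ R := by
    have h := hR.reflect_mem β hβ α hα hβre
    have e : 2 * B α β / B β β = -2 := by
      rw [hab]; field_simp
    rw [e] at h
    convert h using 1
    module
  have h3 : α + (3 : ℕ) • β ∉ R := by
    intro h
    have hnorm : B (α + (3 : ℕ) • β) (α + (3 : ℕ) • β) = 3 * B β β := by
      simp only [map_add, LinearMap.add_apply, hαiso, ← hsym, hab, map_nsmul,
        LinearMap.smul_apply, nsmul_eq_mul]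
      push_cast
      ring
    have hbd : B β (α + (3 : ℕ) • β) = 2 * B β β := by
      simp only [map_add, ← hsym, hab, map_nsmul, nsmul_eq_mul]
      push_cast
      ring
    obtain ⟨k, hk⟩ := hR.pairing_int _ h β hβ (by rw [hnorm]; simpa using hβre)
    rw [hnorm, hbd] at hk
    have h4 : ((4 : ℤ) : ℂ) = ((k * 3 : ℤ) : ℂ) := by
      apply mul_right_cancel₀ hβre
      push_cast
      linear_combination hk
    have h5 : (4 : ℤ) = k * 3 := by exact_mod_cast h4
    omega
  have hg : IsGreatest {q : ℕ | ∀ k : ℕ, k ≤ q → α + k • β ∈ R} 2 := by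
    constructor
    · intro k hk
      interval_cases k
      · simpa using hα
      · simpa [add_comm] using hs
      · exact h2
    · intro q hq
      by_contra hlt
      exact h3 (hq 3 (by omega))
  rw [mPlus, hg.csSup_eq]

/-- For `α` isotropic and `β` real with `(β,α) ≠ 0`: if `β + α` is a real root then
`m_β⁺(α) = 3`, and if `β - α` is a real root then `m_β⁻(α) = 3`. -/
theorem string_of_real_sum {V : Type*} [AddCommGroup V] [Module ℂ V] [FiniteDimensional ℂ V]
    (B : LinearMap.BilinForm ℂ V) (R : Set V) (hR : IsGRS B R)
    (α β : V) (hα : α ∈ R) (hαiso : B α α = 0)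
    (hβ : β ∈ R) (hβre : B β β ≠ 0) (hpair : B β α ≠ 0) :
    (β + α ∈ R → B (β + α) (β + α) ≠ 0 → mPlus R β α = 3) ∧
    (β - α ∈ R → B (β - α) (β - α) ≠ 0 → mMinus R β α = 3) := by
  refine ⟨string_aux B R hR α β hα hαiso hβ hβre hpair, fun hs hsre => ?_⟩
  have e : -β + α = -(β - α) := by abel
  have h := string_aux B R hR α (-β) hα hαiso (hR.neg_mem β hβ) (by simpa using hβre)
    (by simpa using hpair) (by rw [e]; exact hR.neg_mem _ hs)
    (by rw [e, map_neg, map_neg, LinearMap.neg_apply, neg_neg]; exact hsre)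
  rw [← h]
  simp only [mMinus, mPlus, smul_neg, sub_eq_add_neg]
end

section
/- Let R be a generalized root system, α ∈ R^im, β ∈ R^re with (β,α) ≠ 0. If β+α ∈ R and β+α is a real root, then α+2β ∈ R and α+2β is isotropic; similarly, if β−α ∈ R and β−α is a real root, then α−2β ∈ R and α−2β is isotropic. -/
open scoped Classical

theorem iso_aux {V : Type*} [AddCommGroup V] [Module ℂ V]
    (B : LinearMap.BilinForm ℂ V) (R : Set V) (hR : IsGRS B R)
    (α β : V) (hα : α ∈ R) (hαiso : B α α = 0)
    (hβ : β ∈ R) (hβre : B β β ≠ 0) (hpair : B β α ≠ 0)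
    (hs : β + α ∈ R) (hre : B (β + α) (β + α) ≠ 0) :
    α + 2 • β ∈ R ∧ B (α + 2 • β) (α + 2 • β) = 0 := by
  obtain ⟨k, hk⟩ := hR.pairing_int β hβ α hα hβre
  obtain ⟨m, hm⟩ := hR.pairing_int (β + α) hs α hα hre
  have hsym := hR.symm β α
  simp only [map_add, LinearMap.add_apply, hαiso, hsym] at hm
  have h1 : ((k : ℂ) - m * (1 + k)) * B β β = 0 := by linear_combination (m - 1) * hk + hm
  have h2 : (k : ℂ) - m * (1 + k) = 0 := (mul_eq_zero.mp h1).resolve_right hβre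
  have h3 : k - m * (1 + k) = 0 := by exact_mod_cast h2
  have hk0 : k ≠ 0 := by
    rintro rfl
    apply hpair
    rw [hsym]
    simpa using hk
  have h4 : (1 + k) * (1 - m) = 1 := by linarith
  have hk2 : k = -2 := by
    rcases Int.isUnit_iff.mp (IsUnit.of_mul_eq_one _ h4) with h | h <;> omega
  subst hk2
  have hab : 2 * B α β = -2 * B β β := by simpa using hk
  constructor
  · have h := hR.reflect_mem β hβ α hα hβre
    rw [hab, mul_div_assoc, div_self hβre] at h
    convert h using 1
    module
  · simp only [map_add, map_nsmul, LinearMap.add_apply, LinearMap.smul_apply, hαiso, hsym,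
      nsmul_eq_mul]
    push_cast
    linear_combination 2 * hab

/-- For `α` isotropic and `β` real with `(β,α) ≠ 0`: if `β + α` is a real root then
`α + 2β` is an isotropic root, and if `β - α` is a real root then `α - 2β` is an
isotropic root. -/
theorem iso_of_real_sum {V : Type*} [AddCommGroup V] [Module ℂ V] [FiniteDimensional ℂ V]
    (B : LinearMap.BilinForm ℂ V) (R : Set V) (hR : IsGRS B R)
    (α β : V) (hα : α ∈ R) (hαiso : B α α = 0)
    (hβ : β ∈ R) (hβre : B β β ≠ 0) (hpair : B β α ≠ 0) :
    (β + α ∈ R → B (β + α) (β + α) ≠ 0 →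
      α + 2 • β ∈ R ∧ B (α + 2 • β) (α + 2 • β) = 0) ∧
    (β - α ∈ R → B (β - α) (β - α) ≠ 0 →
      α - 2 • β ∈ R ∧ B (α - 2 • β) (α - 2 • β) = 0) := by
  refine ⟨iso_aux B R hR α β hα hαiso hβ hβre hpair, fun hs hre => ?_⟩
  rw [sub_eq_add_neg] at hs hre
  obtain ⟨h1, h2⟩ := iso_aux B R hR (-α) β (hR.neg_mem α hα) (by simpa using hαiso) hβ hβre
    (by simpa using hpair) hs hre
  have e : α - 2 • β = -(-α + 2 • β) := by abel
  rw [e]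
  refine ⟨hR.neg_mem _ h1, ?_⟩
  rw [map_neg, map_neg, LinearMap.neg_apply, neg_neg]
  exact h2
end

section
/- Let R be a generalized root system and α, β ∈ R^im with (α,β) ≠ 0. If k is a nonzero integer and β + kα ∈ R, then k = 1 or k = −1. -/
open scoped Classical

/-- Serganova, Lemma 1.10: for isotropic roots `α, β` with `(α,β) ≠ 0`, if `k` is a
nonzero integer and `β + k • α ∈ R` then `k = 1` or `k = -1`. -/
theorem iso_iso_string {V : Type*} [AddCommGroup V] [Module ℂ V] [FiniteDimensional ℂ V]
    (B : LinearMap.BilinForm ℂ V) (R : Set V) (hR : IsGRS B R)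
    (α β : V) (hα : α ∈ R) (hαiso : B α α = 0)
    (hβ : β ∈ R) (hβiso : B β β = 0) (hpair : B α β ≠ 0)
    (k : ℤ) (hk : k ≠ 0) (hmem : β + k • α ∈ R) :
    k = 1 ∨ k = -1 := by
  have h1 : B α (β + k • α) = B α β := by
    simp [map_zsmul, hαiso]
  have h2 : B (β + k • α) (β + k • α) = 2 * k * B α β := by
    have h3 : B β α = B α β := hR.symm β α
    simp [map_zsmul, hαiso, hβiso, h3]
    ring
  have hkc : (k : ℂ) ≠ 0 := by exact_mod_cast hk
  have hne : B (β + k • α) (β + k • α) ≠ 0 := by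
    rw [h2]
    exact mul_ne_zero (mul_ne_zero two_ne_zero hkc) hpair
  obtain ⟨m, hm⟩ := hR.pairing_int _ hmem α hα hne
  rw [h1, h2] at hm
  have h4 : (2 * B α β) * ((k : ℂ) * m) = (2 * B α β) * 1 := by
    linear_combination -hm
  have h5 : (k : ℂ) * m = 1 := mul_left_cancel₀ (mul_ne_zero two_ne_zero hpair) h4
  have h6 : k * m = 1 := by exact_mod_cast h5
  exact Int.eq_one_or_neg_one_of_mul_eq_one h6
end

section
/- Let R be a generalized root system, α ∈ R^im, β ∈ R^re with (α,β) ≠ 0, and fix a bijection r_α as in axiom (3). If r_α(β) is isotropic, then m_α^+(β) ≤ 2 and m_α^−(β) ≤ 2 (i.e. β+2α ∉ R and β−2α ∉ R). -/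
open scoped Classical

theorem core_string_bound {V : Type*} [AddCommGroup V] [Module ℂ V]
    (B : LinearMap.BilinForm ℂ V) (R : Set V) (hR : IsGRS B R)
    (α : V) (hα : α ∈ R) (hαiso : B α α = 0)
    (r : V → V) (hrbij : Set.BijOn r R R)
    (hr : ∀ β ∈ R, B β α ≠ 0 → (r β = β + α ∨ r β = β - α))
    (β : V) (hβ : β ∈ R) (hpair : B α β ≠ 0)
    (h1 : r β = β + α) (hrβ : B (r β) (r β) = 0) :
    β + (2 : ℕ) • α ∉ R ∧ β - (2 : ℕ) • α ∉ R := by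
  have hs := hR.symm β α
  have hb : B β β = -2 * B α β := by
    rw [h1] at hrβ
    simp only [map_add, LinearMap.add_apply, hs, hαiso] at hrβ
    linear_combination hrβ
  have key : ∀ n : ℤ, (n = 2 ∨ n = -3) → β + ((n : ℂ) + 1) • α ∉ R := by
    intro n hn hmem
    have hnorm : B (β + ((n : ℂ) + 1) • α) (β + ((n : ℂ) + 1) • α) = 2 * n * B α β := by
      simp only [map_add, LinearMap.add_apply, map_smul, LinearMap.smul_apply, smul_eq_mul,
        hs, hαiso, hb]
      ring
    have hp : B α (β + ((n : ℂ) + 1) • α) = B α β := by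
      simp [hαiso]
    have hn0 : (n : ℂ) ≠ 0 := by
      rcases hn with rfl | rfl <;> norm_num
    obtain ⟨k, hk⟩ := hR.pairing_int _ hmem α hα (by
      rw [hnorm]; exact mul_ne_zero (mul_ne_zero two_ne_zero hn0) hpair)
    rw [hp, hnorm] at hk
    have h2 : (1 : ℂ) = k * n := by
      apply mul_right_cancel₀ hpair
      linear_combination hk / 2
    have h3 : (1 : ℤ) = k * n := by exact_mod_cast h2
    rcases hn with rfl | rfl <;> omega
  constructor
  · intro hmem
    have hp : B (β + (2 : ℕ) • α) α ≠ 0 := by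
      simpa [hαiso, hs] using hpair
    rcases hr _ hmem hp with h | h
    · apply key 2 (Or.inl rfl)
      have h4 := hrbij.mapsTo hmem
      rw [h] at h4
      convert h4 using 1
      push_cast
      module
    · have h5 : β + (2 : ℕ) • α = β := by
        apply hrbij.injOn hmem hβ
        rw [h, h1]
        module
      have h6 : α = 0 := by
        have h7 : (2 : ℕ) • α = 0 := by simpa using h5
        have h8 : α = (1 / 2 : ℂ) • ((2 : ℕ) • α) := by module
        rw [h8, h7, smul_zero]
      exact hpair (by simp [h6])
  · intro hmem
    apply key (-3) (Or.inr rfl)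
    convert hmem using 1
    push_cast
    module

theorem bounds_of_not_mem {V : Type*} [AddCommGroup V] (R : Set V) (α β : V)
    (h1 : β + (2 : ℕ) • α ∉ R) (h2 : β - (2 : ℕ) • α ∉ R) :
    mPlus R α β ≤ 2 ∧ mMinus R α β ≤ 2 := by
  constructor
  · refine Nat.succ_le_succ (csSup_le' ?_)
    intro q hq
    by_contra h
    exact h1 (hq 2 (by omega))
  · refine Nat.succ_le_succ (csSup_le' ?_)
    intro q hq
    by_contra h
    exact h2 (hq 2 (by omega))

/-- Lemma 1.5(a): for `α` isotropic, `β` real with `(α,β) ≠ 0`, and `r` a fixed odd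
reflection at `α`, if `r β` is isotropic then `m_α⁺(β) ≤ 2` and `m_α⁻(β) ≤ 2`. -/
theorem string_bound_iso_reflection {V : Type*} [AddCommGroup V] [Module ℂ V]
    [FiniteDimensional ℂ V]
    (B : LinearMap.BilinForm ℂ V) (R : Set V) (hR : IsGRS B R)
    (α : V) (hα : α ∈ R) (hαiso : B α α = 0)
    (r : V → V) (hrbij : Set.BijOn r R R)
    (hr : ∀ β ∈ R, (B β α = 0 → r β = β) ∧ (B β α ≠ 0 → (r β = β + α ∨ r β = β - α)))
    (β : V) (hβ : β ∈ R) (hβre : B β β ≠ 0) (hpair : B α β ≠ 0)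
    (hrβ : B (r β) (r β) = 0) :
    mPlus R α β ≤ 2 ∧ mMinus R α β ≤ 2 := by
  have hp : B β α ≠ 0 := by rw [hR.symm]; exact hpair
  rcases (hr β hβ).2 hp with h | h
  · obtain ⟨h1, h2⟩ := core_string_bound B R hR α hα hαiso r hrbij (fun b hb => (hr b hb).2)
      β hβ hpair h hrβ
    exact bounds_of_not_mem R α β h1 h2
  · obtain ⟨h1, h2⟩ := core_string_bound B R hR (-α) (hR.neg_mem α hα) (by simpa using hαiso)
      r hrbij (fun b hb hne => by
        rcases (hr b hb).2 (by simpa using hne) with h | h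
        · right; simpa using h
        · left; rw [h]; abel)
      β hβ (by simpa using hpair) (by rw [h]; abel) hrβ
    refine bounds_of_not_mem R α β ?_ ?_
    · simpa using h2
    · simpa [sub_eq_add_neg] using h1
end

section
/- Let R be a generalized root system, α ∈ R^im, β ∈ R^re with (α,β) ≠ 0, and fix a bijection r_α as in axiom (3). If r_α(β) is a real root, then m_α^+(β) ≤ 2 and m_α^−(β) ≤ 2 (i.e. β+2α ∉ R and β−2α ∉ R). -/
open scoped Classical

theorem string_key {V : Type*} [AddCommGroup V] [Module ℂ V]
    (B : LinearMap.BilinForm ℂ V) (R : Set V) (hR : IsGRS B R)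
    (α : V) (hα : α ∈ R) (hαiso : B α α = 0)
    (β : V) (hβre : B β β ≠ 0) (t : ℤ) (ht : 2 * B α β = (t : ℂ) * B β β)
    (k : ℤ) (hk : β + k • α ∈ R) :
    B (β + k • α) (β + k • α) = (1 + k * t : ℤ) * B β β ∧
    (k * t = 0 ∨ k * t = -1 ∨ k * t = -2) := by
  have hn : B (β + k • α) (β + k • α) = (1 + k * t : ℤ) * B β β := by
    rw [← Int.cast_smul_eq_zsmul ℂ k α]
    simp only [map_add, map_smul, LinearMap.add_apply, LinearMap.smul_apply, smul_eq_mul, hαiso,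
      hR.symm β α]
    push_cast
    linear_combination (k : ℂ) * ht
  refine ⟨hn, ?_⟩
  by_cases h0 : 1 + k * t = 0
  · right; left; linarith
  have hne : B (β + k • α) (β + k • α) ≠ 0 := by
    rw [hn]; exact mul_ne_zero (by exact_mod_cast h0) hβre
  obtain ⟨m, hm⟩ := hR.pairing_int _ hk α hα hne
  have h2 : 2 * B α (β + k • α) = t * B β β := by
    rw [← Int.cast_smul_eq_zsmul ℂ k α]
    simp only [map_add, map_smul, smul_eq_mul, hαiso]
    linear_combination ht
  rw [h2, hn, ← mul_assoc] at hm
  have h3 : t = m * (1 + k * t) := by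
    have := mul_right_cancel₀ hβre hm
    exact_mod_cast this
  have h4 : (1 + k * t) * (1 - k * m) = 1 := by
    linear_combination k * h3
  rcases Int.eq_one_or_neg_one_of_mul_eq_one h4 with h | h
  · left; linarith
  · right; right; linarith

/-- Lemma 1.5(b): for `α` isotropic, `β` real with `(α,β) ≠ 0`, and `r` a fixed odd
reflection at `α`, if `r β` is a real root then `m_α⁺(β) ≤ 2` and `m_α⁻(β) ≤ 2`. -/
theorem string_bound_real_reflection {V : Type*} [AddCommGroup V] [Module ℂ V]
    [FiniteDimensional ℂ V]
    (B : LinearMap.BilinForm ℂ V) (R : Set V) (hR : IsGRS B R)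
    (α : V) (hα : α ∈ R) (hαiso : B α α = 0)
    (r : V → V) (hrbij : Set.BijOn r R R)
    (hr : ∀ β ∈ R, (B β α = 0 → r β = β) ∧ (B β α ≠ 0 → (r β = β + α ∨ r β = β - α)))
    (β : V) (hβ : β ∈ R) (hβre : B β β ≠ 0) (hpair : B α β ≠ 0)
    (hrβ : B (r β) (r β) ≠ 0) :
    mPlus R α β ≤ 2 ∧ mMinus R α β ≤ 2 := by
  obtain ⟨t, ht⟩ := hR.pairing_int β hβ α hα hβre
  have key := string_key B R hR α hα hαiso β hβre t ht
  have ht0 : t ≠ 0 := by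
    rintro rfl
    apply hpair
    simpa using ht
  have hrR : r β ∈ R := hrbij.mapsTo hβ
  have htt : t = 2 ∨ t = -2 := by
    rcases (hr β hβ).2 (by rwa [hR.symm]) with h | h
    · have e : r β = β + (1 : ℤ) • α := by rw [h, one_smul]
      rw [e] at hrR hrβ
      obtain ⟨h1, h2⟩ := key 1 hrR
      have h3 : 1 + 1 * t ≠ 0 := by
        intro h0
        rw [h1, h0] at hrβ
        simp at hrβ
      omega
    · have e : r β = β + (-1 : ℤ) • α := by rw [h, neg_smul, one_smul, sub_eq_add_neg]
      rw [e] at hrR hrβ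
      obtain ⟨h1, h2⟩ := key (-1) hrR
      have h3 : 1 + (-1) * t ≠ 0 := by
        intro h0
        rw [h1, h0] at hrβ
        simp at hrβ
      omega
  constructor
  · unfold mPlus
    refine Nat.succ_le_succ (csSup_le' ?_)
    intro q hq
    have h := (key q (by simpa using hq q le_rfl)).2
    rcases htt with rfl | rfl <;> omega
  · unfold mMinus
    refine Nat.succ_le_succ (csSup_le' ?_)
    intro q hq
    have h := (key (-q) (by simpa [sub_eq_add_neg] using hq q le_rfl)).2
    rcases htt with rfl | rfl <;> omega
end

section
/- Let R be an irreducible generalized root system with nonempty R^im, and let Π = {α_1,…,α_n} be a distinguished base of R (a base with the minimal number of isotropic roots). Let α ∈ R and i,j ∈ {1,…,n} with i ≠ j, α ∉ {α_i, −α_i, α_j, −α_j}, and α + α_i − α_j ∈ R. Then α + α_i ∈ R if and only if α − α_j ∈ R. -/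
open scoped Classical

/-- A base of a generalized root system `R`: a tuple `a : Fin n → V` of roots such that
every root is uniquely a `ℤ`-linear combination of the `a i` with either all coefficients
nonnegative or all coefficients nonpositive. -/
def IsBase {V : Type*} [AddCommGroup V] [Module ℂ V] (R : Set V) {n : ℕ}
    (a : Fin n → V) : Prop :=
  (∀ i, a i ∈ R) ∧ ∀ β ∈ R, ∃! k : Fin n → ℤ,
    β = ∑ i, (k i : ℂ) • a i ∧ ((∀ i, 0 ≤ k i) ∨ (∀ i, k i ≤ 0))

/-- A generalized root system is reducible if it is the union of two nonempty mutually
orthogonal subsystems (equivalently, `V` splits as an orthogonal direct sum `V₁ ⊕ V₂`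
with `R = R₁ ∪ R₂`, `Rᵢ ⊆ Vᵢ`). -/
def IsReducibleGRS {V : Type*} [AddCommGroup V] [Module ℂ V]
    (B : LinearMap.BilinForm ℂ V) (R : Set V) : Prop :=
  ∃ R₁ R₂ : Set V, R₁.Nonempty ∧ R₂.Nonempty ∧ R = R₁ ∪ R₂ ∧
    ∀ x ∈ R₁, ∀ y ∈ R₂, B x y = 0

/-- A distinguished base: a base with the minimal possible number of isotropic roots. -/
def IsDistinguishedBase {V : Type*} [AddCommGroup V] [Module ℂ V]
    (B : LinearMap.BilinForm ℂ V) (R : Set V) {n : ℕ} (a : Fin n → V) : Prop :=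
  IsBase R a ∧ ∀ (m : ℕ) (b : Fin m → V), IsBase R b →
    {i : Fin n | B (a i) (a i) = 0}.ncard ≤ {i : Fin m | B (b i) (b i) = 0}.ncard

section GRSHelpers
set_option linter.unusedSectionVars false
set_option linter.unusedSimpArgs false


variable {V : Type*} [AddCommGroup V] [Module ℂ V] [FiniteDimensional ℂ V]
  {B : LinearMap.BilinForm ℂ V} {R : Set V}

/-- The coroot functional of a vector. -/
noncomputable def grsCoroot (B : LinearMap.BilinForm ℂ V) (x : V) : Module.Dual ℂ V :=
  (2 / B x x) • B x


lemma grsCoroot_apply (x y : V) : grsCoroot B x y = 2 * B x y / B x x := by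
  simp [grsCoroot]; ring


lemma grsCoroot_mapsTo (hR : IsGRS B R) {x : V} (hx : x ∈ R) (hxx : B x x ≠ 0) :
    Set.MapsTo (Module.preReflection x (grsCoroot B x)) R R := by
  intro y hy
  rw [Module.preReflection_apply, grsCoroot_apply, hR.symm x y]
  exact hR.reflect_mem x hx y hy hxx


lemma grs_eq_of_two (hR : IsGRS B R) {x y : V} (hx : x ∈ R) (hy : y ∈ R)
    (hxx : B x x ≠ 0) (h1 : B x y = B x x) (h2 : B x y = B y y) : x = y := by
  have hyy : B y y ≠ 0 := by rw [← h2, h1]; exact hxx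
  have : IsAddTorsionFree V := by have := IsAddTorsionFree.of_isTorsionFree ℂ V; exact this
  refine Module.eq_of_mapsTo_reflection_of_mem (R := ℂ) (f := grsCoroot B x) (g := grsCoroot B y)
    hR.finite ?_ ?_ ?_ ?_
    (grsCoroot_mapsTo hR hx hxx) (grsCoroot_mapsTo hR hy hyy) hy
  · rw [grsCoroot_apply]; field_simp
  · rw [grsCoroot_apply]; field_simp
  · rw [grsCoroot_apply, hR.symm y x, h2]; field_simp
  · rw [grsCoroot_apply, h1]; field_simp


lemma grs_reflect_norm (hR : IsGRS B R) {x : V} (hxx : B x x ≠ 0) (y : V) :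
    B (y - (2 * B y x / B x x) • x) (y - (2 * B y x / B x x) • x) = B y y := by
  simp only [map_sub, map_smul, LinearMap.sub_apply, LinearMap.smul_apply, smul_eq_mul]
  rw [hR.symm x y]
  field_simp
  ring

/-- The coroot embedding of the non-isotropic roots. -/
noncomputable def grsCorootEmb (hR : IsGRS B R) :
    {x : V // x ∈ R ∧ B x x ≠ 0} ↪ Module.Dual ℂ V where
  toFun x := grsCoroot B x.1
  inj' := by
    intro x y hxy
    have hxy' : ∀ z, grsCoroot B x.1 z = grsCoroot B y.1 z := fun z => by
      have := congrArg (fun f : Module.Dual ℂ V => f z) hxy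
      simpa using this
    have hxx := x.2.2
    have hyy := y.2.2
    have e1 := hxy' x.1
    have e2 := hxy' y.1
    simp only [grsCoroot_apply] at e1 e2
    rw [hR.symm y.1 x.1] at e1
    field_simp at e1 e2
    exact Subtype.ext (grs_eq_of_two hR x.2.1 y.2.1 hxx e2 e1.symm)

lemma grsCorootEmb_apply (hR : IsGRS B R) (x : {x : V // x ∈ R ∧ B x x ≠ 0}) (y : V) :
    grsCorootEmb hR x y = 2 * B x.1 y / B x.1 x.1 := grsCoroot_apply _ _

/-- The root pairing of the non-isotropic roots. -/
noncomputable def grsPairing (hR : IsGRS B R) :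
    RootPairing {x : V // x ∈ R ∧ B x x ≠ 0} ℂ V (Module.Dual ℂ V) :=
  have : Finite {x : V // x ∈ R ∧ B x x ≠ 0} :=
    (hR.finite.subset (fun _ h => h.1 : {x : V | x ∈ R ∧ B x x ≠ 0} ⊆ R)).to_subtype
  RootPairing.mk' (Module.Dual.eval ℂ V) (Function.Embedding.subtype _)
    (grsCorootEmb hR)
    (by
      intro x
      have hxx := x.2.2
      simp only [Function.Embedding.subtype_apply, Module.Dual.eval_apply]
      rw [grsCorootEmb_apply, mul_div_cancel_right₀ _ hxx])
    (by
      rintro x - ⟨y, rfl⟩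
      refine ⟨⟨y.1 - (2 * B y.1 x.1 / B x.1 x.1) • x.1,
        hR.reflect_mem _ x.2.1 _ y.2.1 x.2.2, ?_⟩, ?_⟩
      · rw [grs_reflect_norm hR x.2.2]; exact y.2.2
      · simp [Module.preReflection_apply, grsCorootEmb_apply, hR.symm x.1 y.1])
    (by
      rintro x - ⟨y, rfl⟩
      refine ⟨⟨y.1 - (2 * B y.1 x.1 / B x.1 x.1) • x.1,
        hR.reflect_mem _ x.2.1 _ y.2.1 x.2.2, ?_⟩, ?_⟩
      · rw [grs_reflect_norm hR x.2.2]; exact y.2.2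
      · ext z
        have hxx := x.2.2
        have hyy := y.2.2
        simp only [Function.Embedding.subtype_apply,
          Module.preReflection_apply, grsCorootEmb_apply, grs_reflect_norm hR x.2.2,
          LinearMap.sub_apply, LinearMap.smul_apply, Module.Dual.eval_apply, smul_eq_mul]
        simp only [map_sub, map_smul, LinearMap.sub_apply, LinearMap.smul_apply, smul_eq_mul]
        field_simp)

lemma grs_pair_bound (hR : IsGRS B R) {x y : V} (hx : x ∈ R) (hy : y ∈ R)
    (hxx : B x x ≠ 0) (hyy : B y y ≠ 0) {k l : ℤ}
    (hk : 2 * B x y = k * B x x) (hl : 2 * B x y = l * B y y) : 0 ≤ k * l ∧ k * l ≤ 4 := by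
  have : Finite {x : V // x ∈ R ∧ B x x ≠ 0} :=
    (hR.finite.subset (fun _ h => h.1 : {x : V | x ∈ R ∧ B x x ≠ 0} ⊆ R)).to_subtype
  have hp : ∀ i j, (grsPairing hR).pairing i j = 2 * B j.1 i.1 / B j.1 j.1 := by
    intro i j
    exact grsCoroot_apply _ _
  have : (grsPairing hR).IsCrystallographic := ⟨by
    intro i j
    obtain ⟨z, hz⟩ := hR.pairing_int _ j.2.1 _ i.2.1 j.2.2
    refine ⟨z, ?_⟩
    have := hp i j
    rw [this, hR.symm, hz, mul_div_cancel_right₀ _ j.2.2]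
    simp⟩
  have := (grsPairing hR).coxeterWeightIn_mem_set_of_isCrystallographic ⟨x, hx, hxx⟩ ⟨y, hy, hyy⟩
  have e : (grsPairing hR).coxeterWeightIn ℤ ⟨x, hx, hxx⟩ ⟨y, hy, hyy⟩ = k * l := by
    have : algebraMap ℤ ℂ ((grsPairing hR).coxeterWeightIn ℤ ⟨x, hx, hxx⟩ ⟨y, hy, hyy⟩)
      = algebraMap ℤ ℂ (k * l) := by
      rw [RootPairing.algebraMap_coxeterWeightIn, RootPairing.coxeterWeight, hp, hp]
      simp only [hR.symm y x, hk]
      rw [← hk, hl, mul_div_cancel_right₀ _ hyy, ← hl, hk, mul_div_cancel_right₀ _ hxx]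
      push_cast
      simp [mul_comm]
    exact_mod_cast this
  rw [e] at this
  simp only [Set.mem_insert_iff, Set.mem_singleton_iff] at this
  generalize k * l = m at this
  omega

lemma grs_neg_mem_iff (hR : IsGRS B R) {x : V} : -x ∈ R ↔ x ∈ R :=
  ⟨fun h => by simpa using hR.neg_mem _ h, hR.neg_mem x⟩

lemma grs_sub_comm (hR : IsGRS B R) {x y : V} : x - y ∈ R ↔ y - x ∈ R := by
  rw [← grs_neg_mem_iff hR, neg_sub]

/-- Odd reflection: one of `y ± x` is a root. -/
lemma grs_iso (hR : IsGRS B R) {x y : V} (hx : x ∈ R) (hy : y ∈ R) (hxx : B x x = 0)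
    (hxy : B x y ≠ 0) : y + x ∈ R ∨ y - x ∈ R := by
  obtain ⟨r, hr, h⟩ := hR.iso_reflect x hx hxx
  have hm := hr.mapsTo hy
  rw [hR.symm] at hxy
  rcases (h y hy).2 hxy with e | e <;> rw [e] at hm
  · exact Or.inl hm
  · exact Or.inr hm

/-- Integrality in the form `2 (x,y) = k (x,x)`. -/
lemma grs_int (hR : IsGRS B R) {x y : V} (hx : x ∈ R) (hy : y ∈ R) (hxx : B x x ≠ 0) :
    ∃ k : ℤ, 2 * B x y = k * B x x := by
  obtain ⟨k, hk⟩ := hR.pairing_int x hx y hy hxx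
  exact ⟨k, by rw [hR.symm, hk]⟩

lemma grs_refl (hR : IsGRS B R) {x y : V} (hx : x ∈ R) (hy : y ∈ R) (hxx : B x x ≠ 0)
    {k : ℤ} (hk : 2 * B x y = k * B x x) : y - (k : ℂ) • x ∈ R := by
  have := hR.reflect_mem x hx y hy hxx
  rwa [hR.symm, hk, mul_div_cancel_right₀ _ hxx] at this

/-- No rational non-integer pairing: `a (x,x)`-type contradiction. -/
lemma grs_ratio (hR : IsGRS B R) {x y : V} (hx : x ∈ R) (hy : y ∈ R) {g : ℂ} (hg : g ≠ 0)
    {a b : ℤ} (ha : a ≠ 0) (h1 : B x x = a * g) (h2 : 2 * B x y = b * g) : a ∣ b := by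
  have hxx : B x x ≠ 0 := by
    rw [h1]; exact mul_ne_zero (by exact_mod_cast ha) hg
  obtain ⟨k, hk⟩ := grs_int hR hx hy hxx
  rw [h1, h2, ← mul_assoc] at hk
  have := mul_right_cancel₀ hg hk
  exact ⟨k, by rw [mul_comm]; exact_mod_cast this⟩

/-- Real-real: positive pairing implies difference is a root. -/
lemma grs_sub_real (hR : IsGRS B R) {x y : V} (hx : x ∈ R) (hy : y ∈ R)
    (hxx : B x x ≠ 0) (hyy : B y y ≠ 0) (hne : x ≠ y) {k : ℤ} (hk : 2 * B x y = k * B x x)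
    (hpos : 0 < k) : x - y ∈ R := by
  obtain ⟨l, hl⟩ := grs_int hR hy hx hyy
  rw [hR.symm y x] at hl
  have hb := grs_pair_bound hR hx hy hxx hyy hk hl
  have hl0 : l ≠ 0 := by
    rintro rfl
    rw [hl] at hk
    have : (k : ℂ) * B x x ≠ 0 := mul_ne_zero (by exact_mod_cast hpos.ne') hxx
    simp at hk
    exact hk.elim (fun h => hpos.ne' h) hxx
  have hlpos : 0 < l := by
    rcases lt_trichotomy l 0 with h | h | h
    · nlinarith [hb.1]
    · exact absurd h hl0
    · exact h
  by_cases hk1 : k = 1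
  · subst hk1
    have := grs_refl hR hx hy hxx hk
    rw [grs_sub_comm hR]
    simpa using this
  by_cases hl1 : l = 1
  · subst hl1
    have := grs_refl hR hy hx hyy (k := 1) (by rw [hR.symm y x]; exact hl)
    simpa using this
  exfalso
  have hk2 : k = 2 := by
    have : 2 ≤ k := by omega
    have : 2 ≤ l := by omega
    nlinarith [hb.2]
  have hl2 : l = 2 := by
    have : 2 ≤ l := by omega
    subst hk2
    linarith [hb.2]
  subst hk2 hl2
  refine hne (grs_eq_of_two hR hx hy hxx ?_ ?_)
  · push_cast at hk; exact mul_left_cancel₀ two_ne_zero hk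
  · push_cast at hl; exact mul_left_cancel₀ two_ne_zero hl

/-- Isotropic `x` orthogonal to real `b`: `x + b` is not a root. -/
lemma grs_A0 (hR : IsGRS B R) {x b : V} (hx : x ∈ R) (hb : b ∈ R)
    (hxx : B x x = 0) (hbb : B b b ≠ 0) (h : B b x = 0) : x + b ∉ R := by
  intro hm
  have h' : B x b = 0 := by rw [hR.symm, h]
  have := grs_eq_of_two hR hb hm hbb (by simp [h]) (by simp [h, h', hxx])
  apply hR.zero_not_mem
  have e : x = 0 := by simpa using this
  rwa [e] at hx

lemma grs_A1 (hR : IsGRS B R) {x b : V} (hx : x ∈ R) (hb : b ∈ R)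
    (hxx : B x x = 0) (hbb : B b b ≠ 0) {k : ℤ} (hk : 2 * B b x = k * B b b) (hpos : 0 < k) :
    x - b ∈ R ∧ x + b ∉ R ∧ k ≤ 2 := by
  have hk' : 2 * B x b = k * B b b := by rw [hR.symm, hk]
  have h2 : x + b ∉ R := by
    intro hm
    have := grs_ratio hR hm hb hbb (a := k + 1) (b := k + 2) (by omega)
      (by simp only [map_add, LinearMap.add_apply, hxx]; push_cast; linear_combination (hk + hk')/2)
      (by simp only [map_add, LinearMap.add_apply]; push_cast; linear_combination hk')
    obtain ⟨c, hc⟩ := this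
    have : 0 < c := by by_contra h; nlinarith
    have : c < 2 := by by_contra h; nlinarith
    have : c = 1 := by omega
    subst this; omega
  have h1 : x - b ∈ R := by
    have hne : B x b ≠ 0 := by
      intro h0
      rw [h0] at hk'
      have : (k : ℂ) * B b b ≠ 0 := mul_ne_zero (by exact_mod_cast hpos.ne') hbb
      exact this (by rw [← hk']; simp)
    rcases grs_iso hR hx hb hxx hne with h | h
    · rw [add_comm] at h; exact absurd h h2
    · rwa [grs_sub_comm hR]
  refine ⟨h1, h2, ?_⟩
  by_contra hcon
  have := grs_ratio hR h1 hb hbb (a := 1 - k) (b := k - 2) (by omega)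
      (by simp only [map_sub, LinearMap.sub_apply, hxx]; push_cast; linear_combination -(hk + hk')/2)
      (by simp only [map_sub, LinearMap.sub_apply]; push_cast; linear_combination hk')
  obtain ⟨c, hc⟩ := this
  have : c < 0 := by by_contra h; nlinarith
  have : -1 < c := by by_contra h; nlinarith
  omega

/-- If `x - b` is a root with `x` isotropic and `b` real, the pairing is `1` or `2`. -/
lemma grs_A2 (hR : IsGRS B R) {x b : V} (hx : x ∈ R) (hb : b ∈ R)
    (hxx : B x x = 0) (hbb : B b b ≠ 0) {k : ℤ} (hk : 2 * B b x = k * B b b) (h : x - b ∈ R) :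
    0 < k := by
  by_contra hcon
  have hnb := hR.neg_mem _ hb
  rw [sub_eq_add_neg] at h
  rcases (not_lt.mp hcon).lt_or_eq with h0 | h0
  · exact (grs_A1 hR hx hnb hxx (by simpa using hbb) (k := -k)
      (by simp only [map_neg, LinearMap.neg_apply]; push_cast; linear_combination -hk)
      (by omega)).2.1 h
  · subst h0
    refine grs_A0 hR hx hnb hxx (by simpa using hbb) ?_ h
    simpa using hk

/-- For any iso `x`, real `b`, the pairing is in `[-2,2]`. -/
lemma grs_A3 (hR : IsGRS B R) {x b : V} (hx : x ∈ R) (hb : b ∈ R)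
    (hxx : B x x = 0) (hbb : B b b ≠ 0) {k : ℤ} (hk : 2 * B b x = k * B b b) :
    -2 ≤ k ∧ k ≤ 2 := by
  constructor
  · by_contra h
    have := (grs_A1 hR hx (hR.neg_mem _ hb) hxx (by simpa using hbb) (k := -k)
      (by simp only [map_neg, LinearMap.neg_apply]; push_cast; linear_combination -hk)
      (by omega)).2.2
    omega
  · by_contra h
    have := (grs_A1 hR hx hb hxx hbb hk (by omega)).2.2
    omega

/-- Real `x`, any root `y ≠ x` with `x - y ∉ R`: non-positive pairing. -/
lemma grs_F (hR : IsGRS B R) {x y : V} (hx : x ∈ R) (hy : y ∈ R)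
    (hxx : B x x ≠ 0) (hne : x ≠ y) (h : x - y ∉ R) :
    ∃ k : ℤ, 2 * B x y = k * B x x ∧ k ≤ 0 := by
  obtain ⟨k, hk⟩ := grs_int hR hx hy hxx
  refine ⟨k, hk, ?_⟩
  by_contra hc
  push Not at hc
  by_cases hyy : B y y = 0
  · exact h ((grs_sub_comm hR).1 (grs_A1 hR hy hx hyy hxx hk hc).1)
  · exact h (grs_sub_real hR hx hy hxx hyy hne hk hc)

/-- Orthogonal isotropic `x, w`; real `u`; pairings `(1,2)` impossible. -/
lemma grs_E (hR : IsGRS B R) {x w u : V} (hx : x ∈ R) (hw : w ∈ R) (hu : u ∈ R)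
    (hxx : B x x = 0) (hww : B w w = 0) (hxw : B x w = 0) (huu : B u u ≠ 0)
    (h1 : 2 * B u x = B u u) (h2 : B u w = B u u) : False := by
  have hw' := grs_refl hR hu hw huu (k := 2) (by rw [h2]; push_cast; ring)
  have hwx : B w x = 0 := by rw [hR.symm, hxw]
  have hxu : B x u = B u u / 2 := by rw [hR.symm]; linear_combination h1 / 2
  have hux : B u x = B u u / 2 := by linear_combination h1 / 2
  have hwu : B w u = B u u := by rw [hR.symm, h2]
  rcases grs_iso hR hx hw' hxx (by simp [hxw, hxu, huu]) with h | h
  · have := grs_ratio hR h hu huu (a := -2) (b := -1) (by norm_num)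
      (by simp [hxw, hxu, hux, hwu, hwx, h2, hxx, hww]; ring)
      (by simp [hxw, hxu, hux, hwu, hwx, h2, hxx, hww]; ring)
    exact absurd this (by decide)
  · have := grs_ratio hR h hu huu (a := 2) (b := -3) (by norm_num)
      (by simp [hxw, hxu, hux, hwu, hwx, h2, hxx, hww]; ring)
      (by simp [hxw, hxu, hux, hwu, hwx, h2, hxx, hww]; ring)
    omega

/-- Orthogonal isotropic `x, w` both pairing `2` with `u` are equal. -/
lemma grs_E2 (hR : IsGRS B R) {x w u : V} (hx : x ∈ R) (hw : w ∈ R) (hu : u ∈ R)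
    (hxx : B x x = 0) (hww : B w w = 0) (hxw : B x w = 0) (huu : B u u ≠ 0)
    (h1 : B u x = B u u) (h2 : B u w = B u u) : x = w := by
  have hxu : B x u = B u u := by rw [hR.symm, h1]
  have hwu : B w u = B u u := by rw [hR.symm, h2]
  have a1 := (grs_A1 hR hx hu hxx huu (k := 2) (by rw [h1]; push_cast; ring) (by norm_num)).1
  have a2 := (grs_A1 hR hw hu hww huu (k := 2) (by rw [h2]; push_cast; ring) (by norm_num)).1
  have := grs_eq_of_two hR a1 a2 (by simp [hxx, h1, hxu, huu])
    (by simp [hxx, hxw, h1, h2, hxu, hwu]) (by simp [hww, hxw, h1, h2, hxu, hwu])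
  simpa using this

/-- The key lemma on triples of orthogonal isotropic roots. -/
lemma grs_W (hR : IsGRS B R) {x y w u : V} (hx : x ∈ R) (hy : y ∈ R) (hs : x + y ∈ R)
    (hw : w ∈ R) (hu : u ∈ R)
    (hxx : B x x = 0) (hyy : B y y = 0) (hww : B w w = 0) (hxy : B x y = 0)
    (hxw : B x w = 0) (hyw : B y w = 0) (huu : B u u ≠ 0)
    (h1 : 2 * B u x = B u u) (h2 : 2 * B u y = - B u u) (h3 : 2 * B u w = B u u) :
    w = x ∨ w = -y := by
  have hyx : B y x = 0 := by rw [hR.symm, hxy]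
  have hwx : B w x = 0 := by rw [hR.symm, hxw]
  have hwy : B w y = 0 := by rw [hR.symm, hyw]
  have hux : B u x = B u u / 2 := by linear_combination h1 / 2
  have huy : B u y = - B u u / 2 := by linear_combination h2 / 2
  have huw : B u w = B u u / 2 := by linear_combination h3 / 2
  have hxu : B x u = B u u / 2 := by rw [hR.symm, hux]
  have hyu : B y u = - B u u / 2 := by rw [hR.symm, huy]
  have hwu : B w u = B u u / 2 := by rw [hR.symm, huw]
  have a1 := (grs_A1 hR hx hu hxx huu (k := 1) (by rw [h1]; push_cast; ring) (by norm_num)).1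
  rcases grs_iso hR hw a1 hww (by simp [hwx, hwu, huu]) with hv | hv
  · have a2 := (grs_A1 hR (hR.neg_mem _ hy) hv (by simp [hyy]) (k := 1)
      (by simp [hxx, hyy, hww, hxy, hxw, hyw, hyx, hwx, hwy, hux, huy, huw, hxu, hyu, hwu, huu]
          intro h0; apply huu; linear_combination -h0)
      (by simp [hxx, hyy, hww, hxy, hxw, hyw, hyx, hwx, hwy, hux, huy, huw, hxu, hyu, hwu, huu]
          ring) (by norm_num)).1
    have a3 : y + (x - u + w) ∈ R := by
      rw [← grs_neg_mem_iff hR]; convert a2 using 1; abel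
    rcases grs_iso hR hw a3 hww (by simp [hwx, hwy, hww, hwu, huu]) with ht | ht
    · right
      have := grs_eq_of_two hR hv ht
        (by simp [hxx, hyy, hww, hxy, hxw, hyw, hyx, hwx, hwy, hux, huy, huw, hxu, hyu, hwu]
            intro h0; apply huu; linear_combination -h0)
        (by simp [hxx, hyy, hww, hxy, hxw, hyw, hyx, hwx, hwy, hux, huy, huw, hxu, hyu, hwu]
            ring)
        (by simp [hxx, hyy, hww, hxy, hxw, hyw, hyx, hwx, hwy, hux, huy, huw, hxu, hyu, hwu]
            ring)
      have e : (y + w) + (x - u + w) = x - u + w := by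
        conv_rhs => rw [this]
        abel
      have e2 : y + w = 0 := by simpa using e
      exact eq_neg_of_add_eq_zero_right e2
    · exfalso
      refine grs_A0 hR hs (hR.neg_mem _ hu) (by simp [hxx, hxy, hyx, hyy]) (by simpa using huu)
        (by simp [hux, huy]; ring) ?_
      convert ht using 1; abel
  · left
    have := grs_eq_of_two hR hu (hR.neg_mem _ hv) huu
        (by simp [hxx, hyy, hww, hxy, hxw, hyw, hyx, hwx, hwy, hux, huy, huw, hxu, hyu, hwu]
            )
        (by simp [hxx, hyy, hww, hxy, hxw, hyw, hyx, hwx, hwy, hux, huy, huw, hxu, hyu, hwu]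
            )
    have e : w - x = (-(x - u - w)) - u := by abel
    rw [← this, sub_self] at e
    exact sub_eq_zero.1 e

/-- A square configuration: `γ = α + p = β + q` with no cross-difference a root. -/
structure GrsCfg (R : Set V) (α p β q γ : V) : Prop where
  hα : α ∈ R
  hp : p ∈ R
  hβ : β ∈ R
  hq : q ∈ R
  hγ : γ ∈ R
  e1 : γ = α + p
  e2 : γ = β + q
  n1 : α - β ∉ R
  n2 : α - q ∉ R
  n3 : p - β ∉ R
  n4 : p - q ∉ R
  d1 : α ≠ β
  d2 : α ≠ q
  d3 : p ≠ β
  d4 : p ≠ q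

lemma GrsCfg.swapL {α p β q γ : V} (h : GrsCfg R α p β q γ) : GrsCfg R p α β q γ :=
  ⟨h.hp, h.hα, h.hβ, h.hq, h.hγ, by rw [h.e1, add_comm], h.e2, h.n3, h.n4, h.n1, h.n2,
    h.d3, h.d4, h.d1, h.d2⟩

lemma GrsCfg.swapR {α p β q γ : V} (h : GrsCfg R α p β q γ) : GrsCfg R α p q β γ :=
  ⟨h.hα, h.hp, h.hq, h.hβ, h.hγ, h.e1, by rw [h.e2, add_comm], h.n2, h.n1, h.n4, h.n3,
    h.d2, h.d1, h.d4, h.d3⟩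

lemma GrsCfg.swapLR (hR : IsGRS B R) {α p β q γ : V} (h : GrsCfg R α p β q γ) :
    GrsCfg R β q α p γ :=
  ⟨h.hβ, h.hq, h.hα, h.hp, h.hγ, h.e2, h.e1, fun t => h.n1 ((grs_sub_comm hR).1 t),
    fun t => h.n3 ((grs_sub_comm hR).1 t), fun t => h.n2 ((grs_sub_comm hR).1 t),
    fun t => h.n4 ((grs_sub_comm hR).1 t), h.d1.symm, h.d3.symm, h.d2.symm, h.d4.symm⟩

lemma GrsCfg.pos (hR : IsGRS B R) {α p β q γ : V} (h : GrsCfg R α p β q γ)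
    (hαα : B α α ≠ 0) {k : ℤ} (hk : 2 * B α γ = k * B α α) (hpos : 0 < k) : False := by
  obtain ⟨k1, h1, l1⟩ := grs_F hR h.hα h.hβ hαα h.d1 h.n1
  obtain ⟨k2, h2, l2⟩ := grs_F hR h.hα h.hq hαα h.d2 h.n2
  have : (k : ℂ) * B α α = ((k1 + k2 : ℤ) : ℂ) * B α α := by
    rw [← hk, h.e2, map_add]; push_cast; linear_combination h1 + h2
  have := mul_right_cancel₀ hαα this
  have : k = k1 + k2 := by exact_mod_cast this
  omega

lemma GrsCfg.iso_of_iso (hR : IsGRS B R) {α p β q γ : V} (h : GrsCfg R α p β q γ)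
    (hγγ : B γ γ = 0) : B α α = 0 := by
  by_contra hαα
  obtain ⟨k, hk⟩ := grs_int hR h.hα h.hγ hαα
  refine h.pos hR hαα hk (grs_A2 hR h.hγ h.hα hγγ hαα hk ?_)
  rw [h.e1, add_sub_cancel_left]; exact h.hp

/-- Pairings of `x, y, x + y` orthogonal isotropic with a real root. -/
lemma grs_T (hR : IsGRS B R) {x y u : V} (hx : x ∈ R) (hy : y ∈ R) (hs : x + y ∈ R)
    (hu : u ∈ R) (hxx : B x x = 0) (hyy : B y y = 0) (hxy : B x y = 0) (huu : B u u ≠ 0)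
    {k : ℤ} (hk : 2 * B u (x + y) = k * B u u) (hpos : 0 < k) :
    k = 1 ∧ ((2 * B u x = B u u ∧ B u y = 0) ∨ (B u x = 0 ∧ 2 * B u y = B u u)) := by
  have hyx : B y x = 0 := by rw [hR.symm, hxy]
  have hss : B (x + y) (x + y) = 0 := by simp [hxx, hyy, hxy, hyx]
  obtain ⟨a, ha⟩ := grs_int hR hu hx huu
  obtain ⟨b, hb⟩ := grs_int hR hu hy huu
  have hab : k = a + b := by
    have : (k : ℂ) * B u u = ((a + b : ℤ) : ℂ) * B u u := by
      rw [← hk, map_add]; push_cast; linear_combination ha + hb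
    exact_mod_cast mul_right_cancel₀ huu this
  have ra := grs_A3 hR hx hu hxx huu ha
  have rb := grs_A3 hR hy hu hyy huu hb
  have rk := grs_A3 hR hs hu hss huu hk
  have two : ∀ {v : V}, 2 * B u v = ((2 : ℤ) : ℂ) * B u u → B u v = B u u := by
    intro v hv; push_cast at hv; exact mul_left_cancel₀ two_ne_zero hv
  have c1 : ¬ (a = 2 ∧ b = -1) := by
    rintro ⟨rfl, rfl⟩
    exact grs_E hR (hR.neg_mem _ hy) hx hu (by simpa using hyy) hxx (by simpa using hyx) huu
      (by rw [map_neg]; push_cast at hb; linear_combination -hb) (two ha)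
  have c2 : ¬ (a = -1 ∧ b = 2) := by
    rintro ⟨rfl, rfl⟩
    exact grs_E hR (hR.neg_mem _ hx) hy hu (by simpa using hxx) hyy (by simpa using hxy) huu
      (by rw [map_neg]; push_cast at ha; linear_combination -ha) (two hb)
  have c3 : ¬ (a = 1 ∧ b = 1) := by
    rintro ⟨rfl, rfl⟩
    obtain rfl : k = 2 := by omega
    exact grs_E hR hx hs hu hxx hss (by simp [hxx, hxy]) huu
      (by push_cast at ha; linear_combination ha) (two hk)
  have c4 : ¬ (a = 2 ∧ b = 0) := by
    rintro ⟨rfl, rfl⟩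
    obtain rfl : k = 2 := by omega
    have := grs_E2 hR hx hs hu hxx hss (by simp [hxx, hxy]) huu (two ha) (two hk)
    have e : y = 0 := by simpa using this
    exact hR.zero_not_mem (e ▸ hy)
  have c5 : ¬ (a = 0 ∧ b = 2) := by
    rintro ⟨rfl, rfl⟩
    obtain rfl : k = 2 := by omega
    have := grs_E2 hR hy hs hu hyy hss (by simp [hyy, hyx]) huu (two hb) (two hk)
    have e : x = 0 := by simpa using this
    exact hR.zero_not_mem (e ▸ hx)
  have : (a = 1 ∧ b = 0) ∨ (a = 0 ∧ b = 1) := by omega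
  rcases this with ⟨rfl, rfl⟩ | ⟨rfl, rfl⟩
  · exact ⟨by omega, Or.inl ⟨by simpa using ha, by simpa using hb⟩⟩
  · exact ⟨by omega, Or.inr ⟨by simpa using ha, by simpa using hb⟩⟩

/-- Every isotropic root pairs positively with some real root. -/
lemma grs_exists_real (hR : IsGRS B R) {x : V} (hx : x ∈ R) (hxx : B x x = 0) :
    ∃ u ∈ R, B u u ≠ 0 ∧ ∃ k : ℤ, 2 * B u x = k * B u u ∧ 0 < k := by
  have key : ∃ u ∈ R, B u x ≠ 0 := by
    by_contra hc
    push Not at hc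
    have h0 : ∀ v : V, B v x = 0 := by
      intro v
      have hv : v ∈ Submodule.span ℂ R := by rw [hR.span_eq_top]; trivial
      induction hv using Submodule.span_induction with
      | mem y hy => exact hc y hy
      | zero => simp
      | add y z _ _ h1 h2 => simp [h1, h2]
      | smul c y _ h1 => simp [h1]
    have : x = 0 := hR.nondegenerate.2 x h0
    exact hR.zero_not_mem (this ▸ hx)
  have key2 : ∃ u ∈ R, B u u ≠ 0 ∧ B u x ≠ 0 := by
    obtain ⟨u, hu, hux⟩ := key
    by_cases huu : B u u = 0
    · have hxu : B x u ≠ 0 := by rwa [hR.symm]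
      have e := hR.symm x u
      rcases grs_iso hR hx hu hxx hxu with h | h
      · refine ⟨_, h, ?_, ?_⟩
        · simp [huu, hxx, e]; exact hux
        · simpa [hxx] using hux
      · refine ⟨_, h, ?_, ?_⟩
        · simp only [map_sub, LinearMap.sub_apply, huu, hxx, e]
          intro h0; apply hux; linear_combination -h0 / 2
        · simpa [hxx] using hux
    · exact ⟨u, hu, huu, hux⟩
  obtain ⟨u, hu, huu, hux⟩ := key2
  obtain ⟨k, hk⟩ := grs_int hR hu hx huu
  have hk0 : k ≠ 0 := by
    rintro rfl
    simp at hk; exact hux hk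
  rcases lt_or_gt_of_ne hk0 with h | h
  · exact ⟨-u, hR.neg_mem _ hu, by simpa using huu, -k, by simp; linear_combination hk, by omega⟩
  · exact ⟨u, hu, huu, k, hk, h⟩

lemma GrsCfg.iso_final (hR : IsGRS B R) {α p β q γ u : V} (h : GrsCfg R α p β q γ)
    (hαα : B α α = 0) (hγγ : B γ γ = 0) (hββ : B β β = 0)
    (hαγ : B γ α = 0) (hβγ : B γ β = 0) (hαβ : B α β = 0) (hu : u ∈ R) (huu : B u u ≠ 0)
    (h0 : 2 * B u γ = B u u) (h1 : 2 * B u α = B u u) (h2 : 2 * B u β = B u u) : False := by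
  rcases grs_W hR h.hγ (hR.neg_mem _ h.hα) (by rw [h.e1, add_neg_cancel_comm]; exact h.hp)
    h.hβ hu hγγ (by simpa using hαα) hββ (by simpa using hαγ) hβγ (by simpa using hαβ) huu
    h0 (by rw [map_neg]; linear_combination -h1) h2 with e | e
  · have := h.e2
    rw [e] at this
    have e : q = 0 := by simpa using this
    exact hR.zero_not_mem (e ▸ h.hq)
  · exact h.d1 (by rw [e, neg_neg])

lemma GrsCfg.false_of_iso (hR : IsGRS B R) {α p β q γ : V} (h : GrsCfg R α p β q γ)
    (hγγ : B γ γ = 0) : False := by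
  have hαα := h.iso_of_iso hR hγγ
  have hpp := h.swapL.iso_of_iso hR hγγ
  have hββ := (h.swapLR hR).iso_of_iso hR hγγ
  have hqq := (h.swapLR hR).swapL.iso_of_iso hR hγγ
  have hαp : B α p = 0 := by
    have := hγγ
    rw [h.e1] at this
    simp only [map_add, LinearMap.add_apply, hαα, hpp, hR.symm p α] at this
    linear_combination this / 2
  have hβq : B β q = 0 := by
    have := hγγ
    rw [h.e2] at this
    simp only [map_add, LinearMap.add_apply, hββ, hqq, hR.symm q β] at this
    linear_combination this / 2
  have hpα : B p α = 0 := by rw [hR.symm, hαp]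
  have hqβ : B q β = 0 := by rw [hR.symm, hβq]
  have gα : B α γ = 0 := by rw [h.e1]; simp [hαα, hαp]
  have gp : B p γ = 0 := by rw [h.e1]; simp [hpp, hpα]
  have gβ : B β γ = 0 := by rw [h.e2]; simp [hββ, hβq]
  have gq : B q γ = 0 := by rw [h.e2]; simp [hqq, hqβ]
  have r1 : B α β + B α q = 0 := by rw [← map_add, ← h.e2, gα]
  have r2 : B p β + B p q = 0 := by rw [← map_add, ← h.e2, gp]
  have r3 : B α β + B p β = 0 := by
    rw [hR.symm α, hR.symm p, ← map_add, ← h.e1, gβ]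
  by_cases hc : B α β = 0
  · have hc1 : B α q = 0 := by linear_combination r1 - hc
    have hc2 : B p β = 0 := by linear_combination r3 - hc
    have hc3 : B p q = 0 := by linear_combination r2 - hc2
    obtain ⟨u, hu, huu, k, hk, hpos⟩ := grs_exists_real hR h.hγ hγγ
    have t1 := grs_T hR h.hα h.hp (h.e1 ▸ h.hγ) hu hαα hpp hαp huu (h.e1 ▸ hk) hpos
    have t2 := grs_T hR h.hβ h.hq (h.e2 ▸ h.hγ) hu hββ hqq hβq huu (h.e2 ▸ hk) hpos
    have h0 : 2 * B u γ = B u u := by rw [hk, t1.1]; simp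
    rw [hR.symm] at gα gβ gp gq
    rcases t1.2 with ⟨s, -⟩ | ⟨-, s⟩ <;> rcases t2.2 with ⟨t, -⟩ | ⟨-, t⟩
    · exact h.iso_final hR hαα hγγ hββ gα gβ hc hu huu h0 s t
    · exact h.swapR.iso_final hR hαα hγγ hqq gα gq hc1 hu huu h0 s t
    · exact h.swapL.iso_final hR hpp hγγ hββ gp gβ hc2 hu huu h0 s t
    · exact h.swapL.swapR.iso_final hR hpp hγγ hqq gp gq hc3 hu huu h0 s t
  · have m1 : β + α ∈ R := by
      rcases grs_iso hR h.hα h.hβ hαα hc with t | t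
      · exact t
      · exact absurd ((grs_sub_comm hR).1 t) h.n1
    have m2 : q + p ∈ R := by
      have : B p q ≠ 0 := by
        intro t; apply hc; linear_combination r3 - r2 + t
      rcases grs_iso hR h.hp h.hq hpp this with t | t
      · exact t
      · exact absurd ((grs_sub_comm hR).1 t) h.n4
    have s1 := hR.symm β α
    have s2 := hR.symm q p
    have s3 := hR.symm q α
    have s4 := hR.symm β p
    have := grs_eq_of_two hR m1 (hR.neg_mem _ m2)
      (by simp only [map_add, LinearMap.add_apply, hαα, hββ, s1]
          intro t; apply hc; linear_combination t / 2)
      (by simp only [map_add, map_neg, LinearMap.add_apply, hαα, hββ, s1, s4, hβq, hαp]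
          linear_combination -r1 - r3)
      (by simp only [map_add, map_neg, LinearMap.add_apply, LinearMap.neg_apply,
            hpp, hqq, s2, s4, hβq, hαp]
          linear_combination -r1 - r2*2 + r3)
    have e : γ + γ = 0 := by
      have e3 : γ + γ = (β + α) + (q + p) := by
        nth_rewrite 1 [h.e1]
        rw [h.e2]
        abel
      rw [e3, this, neg_add_cancel]
    have e' : (2 : ℂ) • γ = 0 := by rw [two_smul, e]
    have e'' : γ = 0 := by simpa using e'
    exact hR.zero_not_mem (e'' ▸ h.hγ)

/-- In a square, if `γ` is real, then one of `α`, `p` is isotropic. -/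
lemma GrsCfg.iso_or_iso (hR : IsGRS B R) {α p β q γ : V} (h : GrsCfg R α p β q γ)
    (hγγ : B γ γ ≠ 0) : B α α = 0 ∨ B p p = 0 := by
  by_contra hc
  push Not at hc
  obtain ⟨hαα, hpp⟩ := hc
  have aux : ∀ {α p : V}, GrsCfg R α p β q γ → B α α ≠ 0 → ∀ {m : ℤ},
      2 * B γ α = m * B γ γ → ¬ 0 < m := by
    intro α p h hαα m hm hpos
    obtain ⟨l, hl⟩ := grs_int hR h.hα h.hγ hαα
    have hl' : 2 * B γ α = l * B α α := by rw [hR.symm, hl]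
    have hb := (grs_pair_bound hR h.hγ h.hα hγγ hαα hm hl').1
    refine h.pos hR hαα hl ?_
    rcases lt_trichotomy l 0 with t | t | t
    · nlinarith
    · exfalso
      subst t
      rw [hl'] at hm
      have : (m : ℂ) * B γ γ ≠ 0 := mul_ne_zero (by exact_mod_cast hpos.ne') hγγ
      exact this (by rw [← hm]; simp)
    · exact t
  obtain ⟨m, hm⟩ := grs_int hR h.hγ h.hα hγγ
  obtain ⟨m', hm'⟩ := grs_int hR h.hγ h.hp hγγ
  have a1 := aux h hαα hm
  have a2 := aux h.swapL hpp hm'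
  have : ((2 : ℤ) : ℂ) * B γ γ = ((m + m' : ℤ) : ℂ) * B γ γ := by
    push_cast
    rw [add_mul, ← hm, ← hm', ← mul_add, ← map_add, ← h.e1]
  have : (2 : ℤ) = m + m' := by exact_mod_cast mul_right_cancel₀ hγγ this
  omega

/-- The two possible shapes for one side of a square with `γ` real, `α` isotropic. -/
lemma GrsCfg.shape (hR : IsGRS B R) {α p β q γ : V} (h : GrsCfg R α p β q γ)
    (hγγ : B γ γ ≠ 0) (hαα : B α α = 0) :
    (B p p ≠ 0 ∧ B α γ = B γ γ ∧ B p γ = 0 ∧ B p β = 0 ∧ B p q = 0) ∨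
    (B p p = 0 ∧ B α γ = B γ γ / 2 ∧ B p γ = B γ γ / 2) := by
  have hg : B α γ + B p γ = B γ γ := by
    rw [hR.symm α, hR.symm p, ← map_add, ← h.e1]
  have hg1 : B α γ = B α p := by nth_rewrite 1 [h.e1]; rw [map_add, hαα, zero_add]
  have hg2 : B p γ = B α p + B p p := by
    nth_rewrite 1 [h.e1]; rw [map_add, hR.symm p α]
  by_cases hpp : B p p = 0
  · right
    refine ⟨hpp, ?_, ?_⟩
    · linear_combination hg / 2 - hg2 / 2 - hpp / 2 + hg1 / 2
    · linear_combination hg / 2 + hg2 / 2 + hpp / 2 - hg1 / 2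
  · left
    obtain ⟨k, hk⟩ := grs_int hR h.hγ h.hα hγγ
    have hm : α - γ ∈ R := by
      rw [grs_sub_comm hR, h.e1, add_sub_cancel_left]; exact h.hp
    have k0 := grs_A2 hR h.hα h.hγ hαα hγγ hk hm
    have k2 := (grs_A1 hR h.hα h.hγ hαα hγγ hk k0).2.2
    rw [hR.symm] at hk
    have k1 : k ≠ 1 := by
      rintro rfl
      apply hpp
      push_cast at hk
      linear_combination hg - hg2 + hg1 - hk
    obtain rfl : k = 2 := by omega
    have ha : B α γ = B γ γ := by push_cast at hk; linear_combination hk / 2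
    have hb : B p γ = 0 := by linear_combination hg - ha
    refine ⟨hpp, ha, hb, ?_⟩
    obtain ⟨k1, h1, l1⟩ := grs_F hR h.hp h.hβ hpp h.d3 h.n3
    obtain ⟨k2, h2, l2⟩ := grs_F hR h.hp h.hq hpp h.d4 h.n4
    have hs : B p β + B p q = 0 := by rw [← map_add, ← h.e2, hb]
    have : ((k1 + k2 : ℤ) : ℂ) * B p p = 0 := by
      push_cast; linear_combination 2 * hs - h1 - h2
    have : k1 + k2 = 0 := by
      have := (mul_eq_zero.1 this).resolve_right hpp
      exact_mod_cast this
    obtain rfl : k1 = 0 := by omega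
    obtain rfl : k2 = 0 := by omega
    constructor
    · simpa using h1
    · simpa using h2

lemma GrsCfg.add_mem (hR : IsGRS B R) {α p β q γ : V} (h : GrsCfg R α p β q γ)
    (hαα : B α α = 0) (hc : B α β ≠ 0) : α + β ∈ R := by
  rcases grs_iso hR h.hα h.hβ hαα hc with t | t
  · rwa [add_comm]
  · exact absurd ((grs_sub_comm hR).1 t) h.n1

/-- Constraint on the pairing `c = (α, β)` of two isotropic corners. -/
lemma GrsCfg.sum_bound (hR : IsGRS B R) {α p β q γ : V} (h : GrsCfg R α p β q γ)
    (hγγ : B γ γ ≠ 0) (hαα : B α α = 0) (hββ : B β β = 0) (hc : B α β ≠ 0)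
    {k : ℤ} (hk : 2 * (B α γ + B β γ) = k * B γ γ) (hk0 : 0 < k) :
    ∃ l : ℤ, 0 < l ∧ k * l ≤ 4 ∧ k * B γ γ = l * (2 * B α β) := by
  have hm := h.add_mem hR hαα hc
  have hn : B (α + β) (α + β) = 2 * B α β := by
    simp only [map_add, LinearMap.add_apply, hαα, hββ, hR.symm β α]; ring
  have hn0 : B (α + β) (α + β) ≠ 0 := by rw [hn]; exact mul_ne_zero two_ne_zero hc
  obtain ⟨l, hl⟩ := grs_int hR hm h.hγ hn0
  have hk' : 2 * B (α + β) γ = k * B γ γ := by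
    rw [← hk]; simp
  have hb := grs_pair_bound hR hm h.hγ hn0 hγγ hl hk'
  have he : (k : ℂ) * B γ γ = l * (2 * B α β) := by rw [← hk', hl, hn]
  refine ⟨l, ?_, by rw [mul_comm]; exact hb.2, he⟩
  rcases lt_trichotomy l 0 with t | t | t
  · nlinarith [hb.1]
  · exfalso
    subst t
    have : (k : ℂ) * B γ γ ≠ 0 := mul_ne_zero (by exact_mod_cast hk0.ne') hγγ
    exact this (by rw [he]; simp)
  · exact t

/-- Mixed case. -/
lemma GrsCfg.mixed (hR : IsGRS B R) {α p β q γ : V} (h : GrsCfg R α p β q γ)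
    (hγγ : B γ γ ≠ 0) (hαα : B α α = 0) (hββ : B β β = 0)
    (h1 : B α γ = B γ γ) (h2 : B β γ = B γ γ / 2) :
    B α β = 0 ∨ 2 * B α β = 3 * B γ γ := by
  by_cases hc : B α β = 0
  · exact Or.inl hc
  right
  obtain ⟨l, l0, l4, he⟩ := h.sum_bound hR hγγ hαα hββ hc (k := 3)
    (by rw [h1, h2]; push_cast; ring) (by norm_num)
  obtain rfl : l = 1 := by omega
  push_cast at he
  linear_combination -he

/-- All isotropic case. -/
lemma GrsCfg.allIso (hR : IsGRS B R) {α p β q γ : V} (h : GrsCfg R α p β q γ)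
    (hγγ : B γ γ ≠ 0) (hαα : B α α = 0) (hββ : B β β = 0)
    (h1 : B α γ = B γ γ / 2) (h2 : B β γ = B γ γ / 2) :
    B α β = 0 ∨ B α β = B γ γ := by
  by_cases hc : B α β = 0
  · exact Or.inl hc
  right
  obtain ⟨l, l0, l4, he⟩ := h.sum_bound hR hγγ hαα hββ hc (k := 2)
    (by rw [h1, h2]; push_cast; ring) (by norm_num)
  have : l = 1 ∨ l = 2 := by omega
  rcases this with rfl | rfl
  · push_cast at he
    linear_combination -he / 2
  · exfalso
    push_cast at he
    have hm := h.add_mem hR hαα hc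
    have hn : B (α + β) (α + β) = 2 * B α β := by
      simp only [map_add, LinearMap.add_apply, hαα, hββ, hR.symm β α]; ring
    have hq : B γ (α + β) = B γ γ := by
      rw [hR.symm]; simp only [map_add, LinearMap.add_apply, h1, h2]; ring
    have := grs_eq_of_two hR h.hγ hm hγγ hq (by rw [hq, hn]; linear_combination he / 2)
    rw [h.e1] at this
    exact h.d3 (add_left_cancel this)

lemma GrsCfg.false_of_corner (hR : IsGRS B R) {α p β q γ : V} (h : GrsCfg R α p β q γ)
    (hγγ : B γ γ ≠ 0) (hαα : B α α = 0) (hββ : B β β = 0) : False := by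
  have hs : B α β + B α q = B α γ := by rw [← map_add, ← h.e2]
  have hs' : B α β + B p β = B β γ := by
    rw [hR.symm α, hR.symm p, ← map_add, ← h.e1]
  rcases h.shape hR hγγ hαα with ⟨hpp, a1, a2, a3, a4⟩ | ⟨hpp, a1, a2⟩ <;>
  rcases (h.swapLR hR).shape hR hγγ hββ with ⟨hqq, b1, b2, b3, b4⟩ | ⟨hqq, b1, b2⟩
  · have hc : B α β = B γ γ := by
      rw [hR.symm α q, b3] at hs; linear_combination hs + a1
    obtain ⟨l, l0, l4, he⟩ := h.sum_bound hR hγγ hαα hββ (by rwa [hc]) (k := 4)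
      (by rw [a1, b1]; push_cast; ring) (by norm_num)
    obtain rfl : l = 1 := by omega
    rw [hc] at he
    push_cast at he
    apply hγγ; linear_combination he / 2
  · rcases h.mixed hR hγγ hαα hββ a1 b1 with c | c <;>
    rcases h.swapR.mixed hR hγγ hαα hqq a1 b2 with d | d <;> apply hγγ
    · linear_combination -hs - a1 + c + d
    · linear_combination -(2 * (-a1 - hs + c) + d)
    · linear_combination -(2 * (-a1 - hs + d) + c)
    · linear_combination (2 * (-a1 - hs) + c + d) / (-4)
  · have g := h.swapLR hR
    rcases g.mixed hR hγγ hββ hαα b1 a1 with c | c <;>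
    rcases g.swapR.mixed hR hγγ hββ hpp b1 a2 with d | d <;> apply hγγ <;>
    rw [hR.symm β α] at c <;> rw [hR.symm β p] at d
    · linear_combination -hs' - b1 + c + d
    · linear_combination -(2 * (-b1 - hs' + c) + d)
    · linear_combination -(2 * (-b1 - hs' + d) + c)
    · linear_combination (2 * (-b1 - hs') + c + d) / (-4)
  · rcases h.allIso hR hγγ hαα hββ a1 b1 with c | c <;>
    rcases h.swapR.allIso hR hγγ hαα hqq a1 b2 with d | d <;> apply hγγ
    · linear_combination 2 * (-a1 - hs + c + d)
    · linear_combination 2 * (a1 + hs - c - d)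
    · linear_combination 2 * (a1 + hs - c - d)
    · linear_combination (2 / 3) * (a1 + hs - c - d)

theorem GrsCfg.false (hR : IsGRS B R) {α p β q γ : V} (h : GrsCfg R α p β q γ) : False := by
  by_cases hγγ : B γ γ = 0
  · exact h.false_of_iso hR hγγ
  rcases h.iso_or_iso hR hγγ with a | a <;>
  rcases (h.swapLR hR).iso_or_iso hR hγγ with b | b
  · exact h.false_of_corner hR hγγ a b
  · exact h.swapR.false_of_corner hR hγγ a b
  · exact h.swapL.false_of_corner hR hγγ a b
  · exact h.swapL.swapR.false_of_corner hR hγγ a b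

lemma grs_base_sub (hR : IsGRS B R) {n : ℕ} {a : Fin n → V} (ha : IsBase R a)
    {i j : Fin n} (hij : i ≠ j) : a i ≠ a j ∧ a i - a j ∉ R := by
  have single : ∀ i, a i = ∑ l, (((Pi.single i 1 : Fin n → ℤ) l : ℤ) : ℂ) • a l := by
    intro i
    rw [Finset.sum_eq_single i]
    · simp
    · intro b _ hb; simp [Pi.single_eq_of_ne hb]
    · simp
  have snn : ∀ i : Fin n, ∀ l, 0 ≤ (Pi.single i 1 : Fin n → ℤ) l := by
    intro i l
    by_cases h : l = i
    · subst h; simp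
    · simp [Pi.single_eq_of_ne h]
  constructor
  · intro e
    have := (ha.2 (a i) (ha.1 i)).unique (y₁ := Pi.single i 1) (y₂ := Pi.single j 1)
      ⟨single i, Or.inl (snn i)⟩ ⟨e.trans (single j), Or.inl (snn j)⟩
    have := congrFun this i
    simp [Pi.single_eq_of_ne hij] at this
  · intro hm
    obtain ⟨k, ⟨hk, hs⟩, -⟩ := ha.2 _ hm
    rcases hs with hs | hs
    · have := (ha.2 (a i) (ha.1 i)).unique (y₁ := Pi.single i 1) (y₂ := k + Pi.single j 1)
        ⟨single i, Or.inl (snn i)⟩ ⟨by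
          simp only [Pi.add_apply, Int.cast_add, add_smul, Finset.sum_add_distrib]
          rw [← hk, ← single j]; abel, Or.inl fun l => add_nonneg (hs l) (snn j l)⟩
      have := congrFun this j
      simp [Pi.single_eq_of_ne hij.symm] at this
      have := hs j
      omega
    · have := (ha.2 (a j) (ha.1 j)).unique (y₁ := Pi.single j 1) (y₂ := Pi.single i 1 - k)
        ⟨single j, Or.inl (snn j)⟩ ⟨by
          simp only [Pi.sub_apply, Int.cast_sub, sub_smul, Finset.sum_sub_distrib]
          rw [← hk, ← single i]; abel, Or.inl fun l => sub_nonneg.2 ((hs l).trans (snn i l))⟩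
      have := congrFun this i
      simp [Pi.single_eq_of_ne hij] at this
      have := hs i
      omega

/-- One direction of the square lemma. -/
lemma grs_square (hR : IsGRS B R) {α x y : V} (hα : α ∈ R) (hx : x ∈ R) (hy : y ∈ R)
    (hne : x ≠ y) (hxy : x - y ∉ R) (h3 : α ≠ y) (hm : α + x - y ∈ R) (hs : α + x ∈ R) :
    α - y ∈ R := by
  by_contra hc
  have e1 : α - (α + x - y) = y - x := by abel
  have e2 : x - (α + x - y) = y - α := by abel
  refine GrsCfg.false hR (α := α) (p := x) (β := α + x - y) (q := y) (γ := α + x)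
    ⟨hα, hx, hm, hy, hs, rfl, by abel, ?_, hc, ?_, hxy, ?_, h3, ?_, hne⟩
  · rw [e1]; exact fun t => hxy ((grs_sub_comm hR).1 t)
  · rw [e2]; exact fun t => hc ((grs_sub_comm hR).1 t)
  · intro t
    rw [← sub_eq_zero, e1, sub_eq_zero] at t
    exact hne t.symm
  · intro t
    rw [← sub_eq_zero, e2, sub_eq_zero] at t
    exact h3 t.symm

end GRSHelpers

/-- Lemma 2.10: in an irreducible GRS with isotropic roots and distinguished base
`α_1, …, α_n`, if `α ∈ R`, `i ≠ j`, `α ∉ {±α_i, ±α_j}` and `α + α_i - α_j ∈ R`, then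
`α + α_i ∈ R` iff `α - α_j ∈ R`. -/
theorem square_lemma {V : Type*} [AddCommGroup V] [Module ℂ V] [FiniteDimensional ℂ V]
    (B : LinearMap.BilinForm ℂ V) (R : Set V) (hR : IsGRS B R)
    (hirr : ¬ IsReducibleGRS B R) (him : ∃ γ ∈ R, B γ γ = 0)
    {n : ℕ} (a : Fin n → V) (hbase : IsDistinguishedBase B R a)
    (α : V) (hα : α ∈ R) (i j : Fin n) (hij : i ≠ j)
    (h1 : α ≠ a i) (h2 : α ≠ -a i) (h3 : α ≠ a j) (h4 : α ≠ -a j)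
    (hmem : α + a i - a j ∈ R) :
    (α + a i ∈ R ↔ α - a j ∈ R) := by
  obtain ⟨hne, hsub⟩ := grs_base_sub hR hbase.1 hij
  have hi := hbase.1.1 i
  have hj := hbase.1.1 j
  constructor
  · exact grs_square hR hα hi hj hne hsub h3 hmem
  · intro hs
    have := grs_square hR (hR.neg_mem _ hα) hj hi hne.symm
      (fun t => hsub ((grs_sub_comm hR).1 t)) (fun t => h2 (by rw [← t, neg_neg]))
      (by rw [← grs_neg_mem_iff hR]; convert hmem using 1; abel)
      (by rw [← grs_neg_mem_iff hR]; convert hs using 1; abel)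
    rw [← grs_neg_mem_iff hR]; convert this using 1; abel
end

section
/- Let R be an irreducible generalized root system with nonempty R^im and distinguished base Π = {α_1,…,α_n}. Let α ∈ R^re and i ≠ j with α_i, α_j ∈ R^re, α ∉ {α_i, −α_i, α_j, −α_j}, and α + α_i − α_j ∈ R. Then it is not the case that both α + α_i and α − α_j lie in R^im. -/
open scoped Classical

theorem grs_no_affine {V : Type*} [AddCommGroup V] [Module ℂ V]
    (B : LinearMap.BilinForm ℂ V) (R : Set V) (hR : IsGRS B R) (x y : V) (hx : x ∈ R)
    (hy : y ∈ R) (c : ℂ) (hc : c ≠ 0) (hxx : B x x = c) (hyy : B y y = c) (hxy : B x y = -c)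
    (hne : x + y ≠ 0) : False := by
  have hyx : B y x = -c := by rw [hR.symm, hxy]
  have key : ∀ n : ℕ, x + (2 * n : ℂ) • (x + y) ∈ R := by
    intro n
    induction n with
    | zero => simpa using hx
    | succ n ih =>
      have e1 := hR.reflect_mem y hy _ ih (by rwa [hyy])
      have v1 : 2 * B (x + (2 * n : ℂ) • (x + y)) y / B y y = -2 := by
        simp only [map_add, map_smul, LinearMap.add_apply, LinearMap.smul_apply, hxy, hyy,
          smul_eq_mul]
        field_simp
        ring
      rw [v1] at e1
      have e2 := hR.reflect_mem x hx _ e1 (by rwa [hxx])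
      have v2 : 2 * B (x + (2 * n : ℂ) • (x + y) - (-2 : ℂ) • y) x / B x x = -2 := by
        simp only [map_add, map_sub, map_smul, LinearMap.add_apply, LinearMap.sub_apply,
          LinearMap.smul_apply, hyx, hxx, smul_eq_mul]
        field_simp
        ring
      rw [v2] at e2
      convert e2 using 1
      push_cast
      module
  have hinj : Function.Injective (fun n : ℕ => x + (2 * n : ℂ) • (x + y)) := by
    intro m n h
    have h' := smul_left_injective ℂ hne (add_left_cancel h)
    have : (m : ℂ) = n := by linear_combination h' / 2
    exact_mod_cast this
  exact Set.infinite_of_injective_forall_mem hinj key hR.finite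

theorem grs_orth {V : Type*} [AddCommGroup V] [Module ℂ V]
    (B : LinearMap.BilinForm ℂ V) (R : Set V) (hR : IsGRS B R) (x y : V) (hx : x ∈ R)
    (hy : y ∈ R) (hxx : B x x ≠ 0) (hyy : B y y ≠ 0)
    (hne : x + y ≠ 0) (h0 : B (x + y) (x + y) = 0) : B x y = 0 := by
  by_contra hxy
  have hyx : B y x = B x y := hR.symm _ _
  obtain ⟨p, hp⟩ := hR.pairing_int y hy x hx hyy
  obtain ⟨q, hq⟩ := hR.pairing_int x hx y hy hxx
  simp only [map_add, LinearMap.add_apply, hyx] at h0 hq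
  have hpq : (p : ℂ) * q + p + q = 0 := by
    have : (2 * B x y) * ((p : ℂ) * q + p + q) = 0 := by
      linear_combination (p : ℂ) * q * h0 + q * hp + p * hq
    rcases mul_eq_zero.1 this with h | h
    · exact absurd h (by simpa using hxy)
    · exact h
  have hpq' : (p + 1) * (q + 1) = 1 := by
    have : p * q + p + q = 0 := by exact_mod_cast hpq
    linarith
  rcases Int.eq_one_or_neg_one_of_mul_eq_one hpq' with h | h
  · have : p = 0 := by omega
    subst this
    apply hxy
    simpa using hp
  · have : p = -2 := by omega
    subst this
    have : q = -2 := by rw [h] at hpq'; omega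
    subst this
    push_cast at hp hq
    exact grs_no_affine B R hR x y hx hy (B y y) hyy
      (by linear_combination (hq - hp) / 2) rfl (by linear_combination hp / 2) hne

theorem base_single {V : Type*} [AddCommGroup V] [Module ℂ V] {R : Set V} {n : ℕ}
    {a : Fin n → V} (hb : IsBase R a) (i : Fin n) (k : Fin n → ℤ) (hk : ∀ l, 0 ≤ k l)
    (h : a i = ∑ l, (k l : ℂ) • a l) : k = Pi.single i 1 := by
  refine (hb.2 (a i) (hb.1 i)).unique ⟨h, Or.inl hk⟩ ⟨?_, Or.inl ?_⟩
  · rw [Finset.sum_eq_single i] <;> simp +contextual [Pi.single_apply]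
  · intro l
    by_cases h : l = i <;> simp [Pi.single_apply, h]

theorem base_sub {V : Type*} [AddCommGroup V] [Module ℂ V] {R : Set V} {n : ℕ}
    {a : Fin n → V} (hb : IsBase R a) (i j : Fin n) (hij : i ≠ j) (k : Fin n → ℤ)
    (hk : ∀ l, 0 ≤ k l)
    (h : a i - a j = ∑ l, (k l : ℂ) • a l) : False := by
  have hs : (∑ l, (((Pi.single j 1 : Fin n → ℤ) l : ℤ) : ℂ) • a l) = a j := by
    rw [Finset.sum_eq_single j] <;> simp +contextual [Pi.single_apply]
  have hn : ∀ l, 0 ≤ (Pi.single j 1 : Fin n → ℤ) l := by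
    intro l
    by_cases h : l = j <;> simp [Pi.single_apply, h]
  have := base_single hb i (k + Pi.single j 1) (fun l => add_nonneg (hk l) (hn l)) (by
    simp only [Pi.add_apply, Int.cast_add, add_smul, Finset.sum_add_distrib, hs, ← h]
    abel)
  have h2 := congrFun this j
  simp [Pi.single_apply, hij.symm] at h2
  have := hk j
  omega

theorem base_sub_not_mem {V : Type*} [AddCommGroup V] [Module ℂ V] {R : Set V} {n : ℕ}
    {a : Fin n → V} (hb : IsBase R a) (i j : Fin n) (hij : i ≠ j) : a i - a j ∉ R := by
  intro hm
  obtain ⟨k, ⟨hk, hs | hs⟩, -⟩ := hb.2 _ hm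
  · exact base_sub hb i j hij k hs hk
  · refine base_sub hb j i hij.symm (-k) (fun l => by simpa using hs l) ?_
    rw [← neg_sub, hk]
    simp

/-- In an irreducible GRS with isotropic roots and distinguished base, if `α` is a real
root, `α_i, α_j` are real simple roots, `i ≠ j`, `α ∉ {±α_i, ±α_j}` and
`α + α_i - α_j ∈ R`, then `α + α_i` and `α - α_j` cannot both be isotropic roots. -/
theorem not_both_isotropic {V : Type*} [AddCommGroup V] [Module ℂ V] [FiniteDimensional ℂ V]
    (B : LinearMap.BilinForm ℂ V) (R : Set V) (hR : IsGRS B R)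
    (hirr : ¬ IsReducibleGRS B R) (him : ∃ γ ∈ R, B γ γ = 0)
    {n : ℕ} (a : Fin n → V) (hbase : IsDistinguishedBase B R a)
    (α : V) (hα : α ∈ R) (hαre : B α α ≠ 0)
    (i j : Fin n) (hij : i ≠ j)
    (hire : B (a i) (a i) ≠ 0) (hjre : B (a j) (a j) ≠ 0)
    (h1 : α ≠ a i) (h2 : α ≠ -a i) (h3 : α ≠ a j) (h4 : α ≠ -a j)
    (hmem : α + a i - a j ∈ R) :
    ¬ ((α + a i ∈ R ∧ B (α + a i) (α + a i) = 0) ∧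
       (α - a j ∈ R ∧ B (α - a j) (α - a j) = 0)) := by
  rintro ⟨⟨hb, hb0⟩, ⟨hg, hg0⟩⟩
  have hB := hbase.1
  have hi := hB.1 i
  have hj := hB.1 j
  have hnj := hR.neg_mem _ hj
  have hai : B α (a i) = 0 := grs_orth B R hR α (a i) hα hi hαre hire
    (fun h => h2 (eq_neg_of_add_eq_zero_left h)) hb0
  have haj : B α (a j) = 0 := by
    have := grs_orth B R hR α (-a j) hα hnj hαre (by simpa using hjre)
      (fun h => h3 (by simpa using eq_neg_of_add_eq_zero_left h))
      (by simpa [sub_eq_add_neg] using hg0)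
    simpa using this
  have hia : B (a i) α = 0 := by rw [hR.symm, hai]
  have hja : B (a j) α = 0 := by rw [hR.symm, haj]
  have hji : B (a j) (a i) = B (a i) (a j) := hR.symm _ _
  obtain ⟨c, hc⟩ : ∃ c, c = B (a i) (a i) := ⟨_, rfl⟩
  have hii := hc.symm
  have hc0 : c ≠ 0 := by rwa [hc]
  have hαα : B α α = -c := by
    simp only [map_add, LinearMap.add_apply, hai, hia, hii] at hb0
    linear_combination hb0
  have hjj : B (a j) (a j) = c := by
    simp only [map_sub, LinearMap.sub_apply, haj, hja, hαα] at hg0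
    linear_combination hg0
  obtain ⟨k, hk⟩ := hR.pairing_int _ hj _ hi hjre
  rw [hjj] at hk
  have hBij : B (a i) (a j) = k * c / 2 := by linear_combination hk / 2
  rw [hBij] at hji
  have hηη : B (α + a i - a j) (α + a i - a j) = (1 - k) * c := by
    simp only [map_add, map_sub, LinearMap.add_apply, LinearMap.sub_apply, hai, hia, haj, hja,
      hii, hjj, hαα, hBij, hji]
    ring
  have hne : a i + -a j ≠ 0 := by
    intro h
    have h' : a i - a j = 0 := by rw [sub_eq_add_neg, h]
    exact base_sub hB i j hij 0 (fun _ => le_rfl) (by simp [h'])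
  have hk1 : k ≠ 1 := by
    rintro rfl
    have := hR.reflect_mem _ hj _ hi hjre
    rw [hk, hjj] at this
    apply base_sub_not_mem hB i j hij
    simpa [hc0] using this
  have hk1' : (1 - k : ℂ) ≠ 0 := by
    rw [sub_ne_zero]
    exact_mod_cast hk1.symm
  have hη0 : B (α + a i - a j) (α + a i - a j) ≠ 0 := by
    rw [hηη]
    exact mul_ne_zero hk1' hc0
  obtain ⟨p, hp⟩ := hR.pairing_int _ hmem _ hα hη0
  obtain ⟨q, hq⟩ := hR.pairing_int _ hmem _ hi hη0
  rw [hηη] at hp hq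
  simp only [map_add, map_sub, hai, haj, hia, hii, hαα, hBij] at hp hq
  have hp' : p * (1 - k) = -2 := by
    have : (p : ℂ) * (1 - k) = -2 := by
      apply mul_right_cancel₀ hc0
      linear_combination -hp
    exact_mod_cast this
  have hq' : q * (1 - k) = 2 - k := by
    have : (q : ℂ) * (1 - k) = 2 - k := by
      apply mul_right_cancel₀ hc0
      linear_combination -hq
    exact_mod_cast this
  -- `1 - k` divides `1`, hence `k = 0` or `k = 2`
  have hu : (q - 1) * (1 - k) = 1 := by linarith
  have hu' : (1 - k) * (q - 1) = 1 := by linarith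
  rcases Int.eq_one_or_neg_one_of_mul_eq_one hu' with h | h
  · have : k = 0 := by omega
    subst this
    have hr := hR.reflect_mem _ hj _ hmem hjre
    have hv : 2 * B (α + a i - a j) (a j) / B (a j) (a j) = -2 := by
      simp only [map_add, map_sub, LinearMap.add_apply, LinearMap.sub_apply, haj, hjj, hBij]
      field_simp
      simp
    rw [hv] at hr
    have he : α + a i - a j - (-2 : ℂ) • a j = α + a i + a j := by module
    rw [he] at hr
    refine grs_no_affine B R hR _ _ hmem hr c hc0 (by rw [hηη]; simp) ?_ ?_ ?_
    · simp only [map_add, LinearMap.add_apply, hai, hia, haj, hja, hii, hjj, hαα, hBij, hji]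
      simp
    · simp only [map_add, map_sub, LinearMap.add_apply, LinearMap.sub_apply, hai, hia, haj, hja,
        hii, hjj, hαα, hBij, hji]
      simp
    · intro h0
      have : (2 : ℂ) • (α + a i) = 0 := by rw [← h0]; module
      rcases smul_eq_zero.1 this with h | h
      · norm_num at h
      · exact hR.zero_not_mem (h ▸ hb)
  · have : k = 2 := by omega
    subst this
    refine grs_no_affine B R hR _ _ hi hnj c hc0 hii (by simp [hjj]) ?_ hne
    simp [hBij]
end
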